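/- Theorem 5.4: For x_n, x_0 ∈ D([0,∞)), x_n ⇒*_S x_0 in D([0,∞)) if and only if in every subsequence (x_{n_k}) one can find a further subsequence (x_{n_{k_l}}) and a strictly increasing sequence T_r → +∞ such that, for every r, the restrictions satisfy x_{n_{k_l}}^{T_r} →_S x_0^{T_r} in D([0,T_r]) as l → ∞. -/

import Mathlib

open MeasureTheory Filter Set Topology

noncomputable section

/-- `x` is càdlàg on `[0,T]`: right-continuous at every `t ∈ [0,T)` and
admitting a left limit at every `t ∈ (0,T]`. -/
def Cadlag (T : ℝ) (x : ℝ → ℝ) : Prop :=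
  (∀ t ∈ Set.Ico (0:ℝ) T, Filter.Tendsto x (nhdsWithin t (Set.Ioi t)) (nhds (x t))) ∧
  (∀ t ∈ Set.Ioc (0:ℝ) T, ∃ L : ℝ, Filter.Tendsto x (nhdsWithin t (Set.Iio t)) (nhds L))

/-- membership in `𝕍`: càdlàg of finite total variation on `[0,T]`. -/
def MemV (T : ℝ) (v : ℝ → ℝ) : Prop :=
  Cadlag T v ∧ BoundedVariationOn v (Set.Icc 0 T)

/-- `μ` is the finite signed (Lebesgue–Stieltjes) measure induced by `v` on `[0,T]`:
`μ([0,t]) = v(t)` for `t ∈ [0,T]`, and `μ` vanishes outside `[0,T]`. -/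
def Represents (T : ℝ) (μ : MeasureTheory.SignedMeasure ℝ) (v : ℝ → ℝ) : Prop :=
  (∀ t ∈ Set.Icc (0:ℝ) T, μ (Set.Icc 0 t) = v t) ∧
  (∀ s : Set ℝ, MeasurableSet s → s ∩ Set.Icc (0:ℝ) T = ∅ → μ s = 0)

/-- Integral of `f` against a signed measure. -/
noncomputable def sInt (μ : MeasureTheory.SignedMeasure ℝ) (f : ℝ → ℝ) : ℝ :=
  (∫ t, f t ∂μ.toJordanDecomposition.posPart) - (∫ t, f t ∂μ.toJordanDecomposition.negPart)

/-- `∫_{[0,T]} f dv` : integral of `f` with respect to the Lebesgue–Stieltjes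
signed measure induced by `v` on `[0,T]`. -/
noncomputable def intD (T : ℝ) (f v : ℝ → ℝ) : ℝ :=
  letI := Classical.propDecidable (∃ μ : MeasureTheory.SignedMeasure ℝ, Represents T μ v)
  if h : ∃ μ : MeasureTheory.SignedMeasure ℝ, Represents T μ v then sInt h.choose f else 0

/-- S-convergence `x_n →_S x₀` on `D([0,T])`. -/
def SConv (T : ℝ) (x : ℕ → ℝ → ℝ) (x₀ : ℝ → ℝ) : Prop :=
  ∀ ε > (0:ℝ), ∃ v : ℕ → ℝ → ℝ, ∃ v₀ : ℝ → ℝ,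
    (∀ n, MemV T (v n)) ∧ MemV T v₀ ∧
    (∀ n, ∀ t ∈ Set.Icc (0:ℝ) T, |x n t - v n t| ≤ ε) ∧
    (∀ t ∈ Set.Icc (0:ℝ) T, |x₀ t - v₀ t| ≤ ε) ∧
    (∀ f : ℝ → ℝ, Continuous f →
      Filter.Tendsto (fun n => intD T f (v n)) Filter.atTop (nhds (intD T f v₀)))

/-- `x_n ⇒*_S x₀` : every subsequence contains a further subsequence `→_S`-converging to `x₀`. -/
def SStarConv (T : ℝ) (x : ℕ → ℝ → ℝ) (x₀ : ℝ → ℝ) : Prop :=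
  ∀ φ : ℕ → ℕ, StrictMono φ →
    ∃ ψ : ℕ → ℕ, StrictMono ψ ∧ SConv T (fun k => x (φ (ψ k))) x₀

/-- membership in `𝔸([0,T])`: continuous, of finite variation, vanishing at `0`. -/
def MemA (T : ℝ) (A : ℝ → ℝ) : Prop :=
  ContinuousOn A (Set.Icc 0 T) ∧ BoundedVariationOn A (Set.Icc 0 T) ∧ A 0 = 0

/-- `A_n →_τ A₀` : uniform convergence on `[0,T]` together with uniformly bounded
total variations. -/
def TauConv (T : ℝ) (A : ℕ → ℝ → ℝ) (A₀ : ℝ → ℝ) : Prop :=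
  TendstoUniformlyOn (fun n => A n) A₀ Filter.atTop (Set.Icc 0 T) ∧
  ∃ M : ℝ, ∀ n, eVariationOn (A n) (Set.Icc 0 T) ≤ ENNReal.ofReal M

/-- `x` has (at least) `k` up-crossings of the levels `a < b` on `[0,T]`. -/
def HasUpcrossings (T a b : ℝ) (x : ℝ → ℝ) (k : ℕ) : Prop :=
  ∃ s u : Fin k → ℝ, (∀ i, 0 ≤ s i ∧ s i < u i ∧ u i ≤ T) ∧
    (∀ i j : Fin k, i < j → u i < s j) ∧
    (∀ i, x (s i) < a ∧ b < x (u i))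

/-- `x` has (at least) `k` `η`-oscillations on `[0,T]`. -/
def HasOscillations (T η : ℝ) (x : ℝ → ℝ) (k : ℕ) : Prop :=
  ∃ s u : Fin k → ℝ, (∀ i, 0 ≤ s i ∧ s i < u i ∧ u i ≤ T) ∧
    (∀ i j : Fin k, i < j → u i ≤ s j) ∧
    (∀ i, |x (u i) - x (s i)| > η)


/-- `x : [0,∞) → ℝ` is càdlàg: right-continuous at every `t ≥ 0`, with left
limits at every `t > 0`. -/
def CadlagInf (x : ℝ → ℝ) : Prop :=
  (∀ t : ℝ, 0 ≤ t → Filter.Tendsto x (nhdsWithin t (Set.Ioi t)) (nhds (x t))) ∧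
  (∀ t : ℝ, 0 < t → ∃ L : ℝ, Filter.Tendsto x (nhdsWithin t (Set.Iio t)) (nhds L))

/-- `x_n ⇒*_S x₀` in `D([0,∞))`: for every `T > 0` and all `A_n, A₀ ∈ 𝔸([0,T])`
with `A_n →_τ A₀`, `∫_0^T x_n dA_n → ∫_0^T x₀ dA₀`. -/
def SStarConvInf (x : ℕ → ℝ → ℝ) (x₀ : ℝ → ℝ) : Prop :=
  ∀ T : ℝ, 0 < T → ∀ A : ℕ → ℝ → ℝ, ∀ A₀ : ℝ → ℝ,
    (∀ n, MemA T (A n)) → MemA T A₀ → TauConv T A A₀ →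
    Filter.Tendsto (fun n => intD T (x n) (A n)) Filter.atTop (nhds (intD T x₀ A₀))

/-- A pair of finite measures on `[0,T]` whose difference is the Lebesgue–Stieltjes signed measure
of `v`. -/
structure RepPair (T : ℝ) (ν₁ ν₂ : Measure ℝ) (v : ℝ → ℝ) : Prop where
  fin₁ : IsFiniteMeasure ν₁
  fin₂ : IsFiniteMeasure ν₂
  null₁ : ν₁ (Icc 0 T)ᶜ = 0
  null₂ : ν₂ (Icc 0 T)ᶜ = 0
  eq : ∀ t ∈ Icc 0 T, ν₁.real (Icc 0 t) - ν₂.real (Icc 0 t) = v t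

/-- `f` is integrable with respect to every finite measure concentrated on `[0,T]`. -/
def FinIntegrable (T : ℝ) (f : ℝ → ℝ) : Prop :=
  ∀ ν : Measure ℝ, IsFiniteMeasure ν → ν (Icc 0 T)ᶜ = 0 → Integrable f ν

lemma RepPair.represents {T : ℝ} {ν₁ ν₂ : Measure ℝ} {v : ℝ → ℝ} (h : RepPair T ν₁ ν₂ v) :
    ∃ μ : SignedMeasure ℝ, Represents T μ v := by
  have := h.fin₁
  have := h.fin₂
  refine ⟨ν₁.toSignedMeasure - ν₂.toSignedMeasure, fun t ht => ?_, fun s hs hsT => ?_⟩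
  · rw [Measure.toSignedMeasure_sub_apply measurableSet_Icc, h.eq t ht]
  · have hsub : s ⊆ (Icc 0 T)ᶜ := fun y hy hyT => by
      have : y ∈ s ∩ Icc 0 T := ⟨hy, hyT⟩
      rw [hsT] at this
      exact this
    rw [Measure.toSignedMeasure_sub_apply hs, measureReal_def, measureReal_def,
      measure_mono_null hsub h.null₁, measure_mono_null hsub h.null₂]
    simp

lemma Represents.repPair {T : ℝ} {μ : SignedMeasure ℝ} {v : ℝ → ℝ} (h : Represents T μ v) :
    RepPair T μ.toJordanDecomposition.posPart μ.toJordanDecomposition.negPart v := by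
  have key : μ.totalVariation (Icc 0 T)ᶜ = 0 := by
    obtain ⟨i, hi, h1, h2, h3, h4⟩ := μ.toJordanDecomposition_spec
    rw [SignedMeasure.totalVariation, Measure.add_apply, h3, h4,
      SignedMeasure.toMeasureOfZeroLE_apply _ _ _ measurableSet_Icc.compl,
      SignedMeasure.toMeasureOfLEZero_apply _ _ _ measurableSet_Icc.compl]
    have e1 : μ (i ∩ (Icc 0 T)ᶜ) = 0 :=
      h.2 _ (hi.inter measurableSet_Icc.compl) (by ext; simp)
    have e2 : μ (iᶜ ∩ (Icc 0 T)ᶜ) = 0 :=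
      h.2 _ (hi.compl.inter measurableSet_Icc.compl) (by ext; simp)
    simp [e1, e2]
  rw [SignedMeasure.totalVariation, Measure.add_apply, add_eq_zero] at key
  exact ⟨inferInstance, inferInstance, key.1, key.2, fun t ht => by
    rw [← SignedMeasure.apply_eq_posPart_real_sub_negPart_real _ measurableSet_Icc, h.1 t ht]⟩

lemma measure_Iic_eq_Icc {T : ℝ} {ν : Measure ℝ} (h : ν (Icc 0 T)ᶜ = 0) (a : ℝ) :
    ν (Iic a) = ν (Icc 0 (min a T)) := by
  apply measure_congr
  have : ∀ᵐ t ∂ν, t ∈ Icc 0 T := by rw [ae_iff]; exact h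
  filter_upwards [this] with t ht
  simp only [eq_iff_iff]
  change t ∈ Iic a ↔ t ∈ Icc 0 (min a T)
  simp only [mem_Iic, mem_Icc, le_min_iff]
  exact ⟨fun h => ⟨ht.1, h, ht.2⟩, fun h => h.2.1⟩

lemma RepPair.add_eq {T : ℝ} {ν₁ ν₂ ν₃ ν₄ : Measure ℝ} {v : ℝ → ℝ} (h : RepPair T ν₁ ν₂ v)
    (h' : RepPair T ν₃ ν₄ v) : ν₁ + ν₄ = ν₃ + ν₂ := by
  have := h.fin₁
  have := h.fin₂
  have := h'.fin₁
  have := h'.fin₂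
  refine Measure.ext_of_Iic _ _ fun a => ?_
  simp only [Measure.add_apply]
  rw [measure_Iic_eq_Icc h.null₁, measure_Iic_eq_Icc h.null₂, measure_Iic_eq_Icc h'.null₁,
    measure_Iic_eq_Icc h'.null₂]
  by_cases ha : 0 ≤ min a T
  · have e := h.eq _ ⟨ha, min_le_right _ _⟩
    have e' := h'.eq _ ⟨ha, min_le_right _ _⟩
    rw [← ENNReal.toReal_eq_toReal_iff' (by finiteness) (by finiteness),
      ENNReal.toReal_add (by finiteness) (by finiteness),
      ENNReal.toReal_add (by finiteness) (by finiteness)]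
    simp only [measureReal_def] at e e'
    linarith
  · simp [Icc_eq_empty ha]

lemma RepPair.intD_eq {T : ℝ} {ν₁ ν₂ : Measure ℝ} {v : ℝ → ℝ} (h : RepPair T ν₁ ν₂ v)
    {f : ℝ → ℝ} (hf : FinIntegrable T f) : intD T f v = ∫ t, f t ∂ν₁ - ∫ t, f t ∂ν₂ := by
  have hex := h.represents
  rw [intD, dif_pos hex, sInt]
  have h' := hex.choose_spec.repPair
  have e := congrArg (fun ν => ∫ t, f t ∂ν) (h.add_eq h')
  rw [integral_add_measure (hf _ h.fin₁ h.null₁) (hf _ h'.fin₂ h'.null₂),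
    integral_add_measure (hf _ h'.fin₁ h'.null₁) (hf _ h.fin₂ h.null₂)] at e
  linarith

lemma RepPair.integral_congr {T : ℝ} {ν : Measure ℝ} (h : ν (Icc 0 T)ᶜ = 0) {f g : ℝ → ℝ}
    (hfg : EqOn f g (Icc 0 T)) : ∫ t, f t ∂ν = ∫ t, g t ∂ν := by
  have : ∀ᵐ t ∂ν, t ∈ Icc 0 T := by rw [ae_iff]; exact h
  exact integral_congr_ae (this.mono fun t ht => hfg ht)

/-- Finite linear combinations of finite measures. -/
lemma RepPair.sum {T : ℝ} {ι : Type*} [Fintype ι] (c : ι → ℝ) (ν : ι → Measure ℝ)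
    [hfin : ∀ i, IsFiniteMeasure (ν i)] (hnull : ∀ i, ν i (Icc 0 T)ᶜ = 0) {v : ℝ → ℝ}
    (hv : ∀ t ∈ Icc 0 T, v t = ∑ i, c i * (ν i).real (Icc 0 t)) :
    RepPair T (∑ i, (c i).toNNReal • ν i) (∑ i, (-c i).toNNReal • ν i) v := by
  refine ⟨inferInstance, inferInstance, ?_, ?_, fun t ht => ?_⟩
  · simp [hnull]
  · simp [hnull]
  · rw [hv t ht]
    simp only [measureReal_def, Measure.coe_finsetSum, Finset.sum_apply]
    rw [ENNReal.toReal_sum (by intro i _; finiteness), ENNReal.toReal_sum (by intro i _; finiteness),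
      ← Finset.sum_sub_distrib]
    refine Finset.sum_congr rfl fun i _ => ?_
    simp only [Measure.smul_apply, ENNReal.toReal_smul, NNReal.smul_def, smul_eq_mul,
      Real.coe_toNNReal']
    rw [← sub_mul]
    congr 1
    rcases le_total 0 (c i) with h | h
    · rw [max_eq_left h, max_eq_right (by linarith)]; ring
    · rw [max_eq_right h, max_eq_left (by linarith)]; ring

lemma intD_sum {T : ℝ} {ι : Type*} [Fintype ι] (c : ι → ℝ) (ν : ι → Measure ℝ)
    [hfin : ∀ i, IsFiniteMeasure (ν i)] (hnull : ∀ i, ν i (Icc 0 T)ᶜ = 0) {v : ℝ → ℝ}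
    (hv : ∀ t ∈ Icc 0 T, v t = ∑ i, c i * (ν i).real (Icc 0 t)) {f : ℝ → ℝ}
    (hf : FinIntegrable T f) : intD T f v = ∑ i, c i * ∫ t, f t ∂(ν i) := by
  rw [(RepPair.sum c ν hnull hv).intD_eq hf, integral_finsetSum_measure, integral_finsetSum_measure,
    ← Finset.sum_sub_distrib]
  · refine Finset.sum_congr rfl fun i _ => ?_
    rw [integral_smul_nnreal_measure, integral_smul_nnreal_measure]
    simp only [NNReal.smul_def, smul_eq_mul, Real.coe_toNNReal']
    rw [← sub_mul]
    congr 1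
    rcases le_total 0 (c i) with h | h
    · rw [max_eq_left h, max_eq_right (by linarith)]; ring
    · rw [max_eq_right h, max_eq_left (by linarith)]; ring
  · exact fun i _ => (hf _ (hfin i) (hnull i)).smul_measure_nnreal
  · exact fun i _ => (hf _ (hfin i) (hnull i)).smul_measure_nnreal

lemma RepPair.abs_intD_le {T : ℝ} {ν₁ ν₂ : Measure ℝ} {v : ℝ → ℝ} (h : RepPair T ν₁ ν₂ v)
    {f : ℝ → ℝ} (hf : FinIntegrable T f) {C : ℝ} (hC : ∀ t ∈ Icc 0 T, |f t| ≤ C) :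
    |intD T f v| ≤ C * (ν₁.real univ + ν₂.real univ) := by
  have := h.fin₁
  have := h.fin₂
  rw [h.intD_eq hf]
  have b : ∀ ν : Measure ℝ, IsFiniteMeasure ν → ν (Icc 0 T)ᶜ = 0 →
      |∫ t, f t ∂ν| ≤ C * ν.real univ := fun ν _ hν => by
    have : ∀ᵐ t ∂ν, t ∈ Icc 0 T := by rw [ae_iff]; exact hν
    exact norm_integral_le_of_norm_le_const (f := f) (C := C) (this.mono fun t ht => hC t ht)
  calc _ ≤ |∫ t, f t ∂ν₁| + |∫ t, f t ∂ν₂| := abs_sub _ _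
    _ ≤ _ := by
      rw [mul_add]; exact add_le_add (b _ h.fin₁ h.null₁) (b _ h.fin₂ h.null₂)

lemma RepPair.intD_sub {T : ℝ} {ν₁ ν₂ : Measure ℝ} {v : ℝ → ℝ} (h : RepPair T ν₁ ν₂ v)
    {f g : ℝ → ℝ} (hf : FinIntegrable T f) (hg : FinIntegrable T g) :
    intD T (fun t => f t - g t) v = intD T f v - intD T g v := by
  have hfg : FinIntegrable T (fun t => f t - g t) := fun ν a b => (hf ν a b).sub (hg ν a b)
  rw [h.intD_eq hf, h.intD_eq hg, h.intD_eq hfg,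
    integral_sub (hf _ h.fin₁ h.null₁) (hg _ h.fin₁ h.null₁),
    integral_sub (hf _ h.fin₂ h.null₂) (hg _ h.fin₂ h.null₂)]
  ring

lemma finIntegrable_of_bounded {T : ℝ} {f g : ℝ → ℝ} (hg : Measurable g)
    (hfg : EqOn f g (Icc 0 T)) {C : ℝ} (hC : ∀ t ∈ Icc 0 T, |f t| ≤ C) : FinIntegrable T f := by
  intro ν _ hν
  have hae : ∀ᵐ t ∂ν, t ∈ Icc 0 T := by rw [ae_iff]; exact hν
  refine Integrable.of_bound (C := C) ?_ (hae.mono fun t ht => hC t ht)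
  exact (hg.aemeasurable.congr (hae.mono fun t ht => (hfg ht).symm)).aestronglyMeasurable

lemma Continuous.finIntegrable {f : ℝ → ℝ} (hf : Continuous f) (T : ℝ) : FinIntegrable T f := by
  obtain ⟨C, hC⟩ := isCompact_Icc.exists_bound_of_continuousOn (s := Icc 0 T) hf.continuousOn
  exact finIntegrable_of_bounded hf.measurable (fun _ _ => rfl) hC

lemma eVariationOn_le_of_sub_monotoneOn {T : ℝ} (hT : 0 ≤ T) {v p q : ℝ → ℝ}
    (hp : MonotoneOn p (Icc 0 T)) (hq : MonotoneOn q (Icc 0 T))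
    (hv : ∀ t ∈ Icc 0 T, v t = p t - q t) :
    eVariationOn v (Icc 0 T) ≤ ENNReal.ofReal ((p T - p 0) + (q T - q 0)) := by
  refine iSup_le ?_
  rintro ⟨n, ⟨u, hu, us⟩⟩
  have hpi : ∀ i, 0 ≤ p (u (i + 1)) - p (u i) := fun i =>
    sub_nonneg.2 (hp (us i) (us (i + 1)) (hu (Nat.le_succ i)))
  have hqi : ∀ i, 0 ≤ q (u (i + 1)) - q (u i) := fun i =>
    sub_nonneg.2 (hq (us i) (us (i + 1)) (hu (Nat.le_succ i)))
  calc ∑ i ∈ Finset.range n, edist (v (u (i + 1))) (v (u i))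
      ≤ ∑ i ∈ Finset.range n, ENNReal.ofReal
          ((p (u (i + 1)) - p (u i)) + (q (u (i + 1)) - q (u i))) := by
        refine Finset.sum_le_sum fun i _ => ?_
        rw [edist_dist, Real.dist_eq, hv _ (us _), hv _ (us _)]
        refine ENNReal.ofReal_le_ofReal (abs_le.2 ⟨?_, ?_⟩) <;> linarith [hpi i, hqi i]
    _ = ENNReal.ofReal ((p (u n) - p (u 0)) + (q (u n) - q (u 0))) := by
        rw [← ENNReal.ofReal_sum_of_nonneg fun i _ => add_nonneg (hpi i) (hqi i),
          Finset.sum_add_distrib, Finset.sum_range_sub (fun i => p (u i)),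
          Finset.sum_range_sub (fun i => q (u i))]
    _ ≤ _ := by
        have h0 : (0 : ℝ) ∈ Icc 0 T := ⟨le_rfl, hT⟩
        have h1 : T ∈ Icc 0 T := ⟨hT, le_rfl⟩
        refine ENNReal.ofReal_le_ofReal ?_
        linarith [hp h0 (us 0) (us 0).1, hp (us n) h1 (us n).2, hq h0 (us 0) (us 0).1,
          hq (us n) h1 (us n).2]

lemma RepPair.eVariationOn_le {T : ℝ} (hT : 0 ≤ T) {ν₁ ν₂ : Measure ℝ} {v : ℝ → ℝ}
    (h : RepPair T ν₁ ν₂ v) :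
    eVariationOn v (Icc 0 T) ≤ ENNReal.ofReal (ν₁.real univ + ν₂.real univ) := by
  have := h.fin₁
  have := h.fin₂
  refine (eVariationOn_le_of_sub_monotoneOn hT (p := fun t => ν₁.real (Icc 0 t))
    (q := fun t => ν₂.real (Icc 0 t)) ?_ ?_ fun t ht => (h.eq t ht).symm).trans ?_
  · exact fun s _ t _ hst => measureReal_mono (Icc_subset_Icc_right hst)
  · exact fun s _ t _ hst => measureReal_mono (Icc_subset_Icc_right hst)
  · refine ENNReal.ofReal_le_ofReal ?_
    have a1 : ν₁.real (Icc 0 T) ≤ ν₁.real univ := measureReal_mono (subset_univ _)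
    have a2 : ν₂.real (Icc 0 T) ≤ ν₂.real univ := measureReal_mono (subset_univ _)
    have a3 : 0 ≤ ν₁.real (Icc 0 0) := measureReal_nonneg
    have a4 : 0 ≤ ν₂.real (Icc 0 0) := measureReal_nonneg
    linarith

/-- Right-continuous functions of bounded variation induce Lebesgue–Stieltjes measures. -/
lemma exists_repPair {T : ℝ} (hT : 0 ≤ T) {v : ℝ → ℝ}
    (hr : ∀ t ∈ Ico 0 T, Tendsto v (𝓝[>] t) (𝓝 (v t))) (hv : BoundedVariationOn v (Icc 0 T)) :
    ∃ ν₁ ν₂, RepPair T ν₁ ν₂ v ∧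
      ν₁.real univ + ν₂.real univ ≤ 3 * (eVariationOn v (Icc 0 T)).toReal + |v 0| := by
  have h0 : (0 : ℝ) ∈ Icc 0 T := ⟨le_rfl, hT⟩
  have hTm : T ∈ Icc 0 T := ⟨hT, le_rfl⟩
  set cl : ℝ → ℝ := fun t => max 0 (min t T) with hcl
  have hclm : Monotone cl := fun s t hst => max_le_max_left _ (min_le_min_right _ hst)
  have hclmem : ∀ t, cl t ∈ Icc 0 T := fun t => ⟨le_max_left _ _, max_le hT (min_le_right _ _)⟩
  have hcleq : ∀ t ∈ Icc 0 T, cl t = t := fun t ht => by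
    simp only [hcl]; rw [min_eq_left ht.2, max_eq_right ht.1]
  set V : ℝ → ℝ := fun t => variationOnFromTo v (Icc 0 T) 0 t with hV
  have hPm : Monotone (fun t => V (cl t)) := fun s t hst =>
    variationOnFromTo.monotoneOn hv.locallyBoundedVariationOn h0 (hclmem s) (hclmem t) (hclm hst)
  have hQm : Monotone (fun t => V (cl t) - v (cl t)) := fun s t hst =>
    variationOnFromTo.sub_self_monotoneOn hv.locallyBoundedVariationOn h0 (hclmem s) (hclmem t)
      (hclm hst)
  set P := hPm.stieltjesFunction with hP
  set Q := hQm.stieltjesFunction with hQ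
  have hPQ : ∀ t ∈ Icc 0 T, P t - Q t = v t := fun t ht => by
    have l := (hPm.tendsto_rightLim t).sub (hQm.tendsto_rightLim t)
    refine tendsto_nhds_unique l ?_
    simp only [sub_sub_cancel]
    rcases ht.2.lt_or_eq with hlt | rfl
    · refine (hr t ⟨ht.1, hlt⟩).congr' ?_
      filter_upwards [Ioo_mem_nhdsGT hlt] with s hs
      rw [hcleq s ⟨ht.1.trans hs.1.le, hs.2.le⟩]
    · refine tendsto_const_nhds.congr' ?_
      filter_upwards [self_mem_nhdsWithin] with s hs
      simp only [hcl]
      rw [min_eq_right (le_of_lt hs), max_eq_right hT]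
  have hVb : ∀ t ∈ Icc 0 T, 0 ≤ V t ∧ V t ≤ (eVariationOn v (Icc 0 T)).toReal := fun t ht =>
    ⟨variationOnFromTo.nonneg_of_le _ _ ht.1,
      (le_abs_self _).trans (variationOnFromTo.abs_le_eVariationOn hv)⟩
  have hP0 : 0 ≤ P 0 := le_trans (hVb _ (hclmem 0)).1 (hPm.le_rightLim le_rfl)
  have hPT : P T ≤ (eVariationOn v (Icc 0 T)).toReal :=
    (hPm.rightLim_le (lt_add_one T)).trans (hVb _ (hclmem _)).2
  have meas : ∀ (F : StieltjesFunction ℝ) (c : ℝ), ∀ t ∈ Icc 0 T,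
      (c.toNNReal • Measure.dirac (0 : ℝ) + F.measure.restrict (Ioc 0 T)).real (Icc 0 t)
        = max c 0 + (F t - F 0) := fun F c t ht => by
    have hinter : Icc 0 t ∩ Ioc 0 T = Ioc 0 t := by
      ext y; simp only [mem_inter_iff, mem_Icc, mem_Ioc]
      exact ⟨fun h => ⟨h.2.1, h.1.2⟩, fun h => ⟨⟨h.1.le, h.2⟩, h.1, h.2.trans ht.2⟩⟩
    have hfin : F.measure.restrict (Ioc 0 T) (Icc 0 t) ≠ ⊤ := by
      rw [Measure.restrict_apply measurableSet_Icc, hinter, StieltjesFunction.measure_Ioc]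
      finiteness
    rw [measureReal_add_apply (h₂ := hfin), measureReal_nnreal_smul_apply,
      measureReal_restrict_apply measurableSet_Icc, hinter]
    simp only [measureReal_def, StieltjesFunction.measure_Ioc]
    rw [ENNReal.toReal_ofReal (sub_nonneg.2 (F.mono ht.1)), Measure.dirac_apply' _ measurableSet_Icc,
      indicator_of_mem (by exact ⟨le_rfl, ht.1⟩)]
    simp
  have nul : ∀ (F : StieltjesFunction ℝ) (c : ℝ),
      (c.toNNReal • Measure.dirac (0 : ℝ) + F.measure.restrict (Ioc 0 T)) (Icc 0 T)ᶜ = 0 :=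
    fun F c => by
    have : (Icc 0 T)ᶜ ∩ Ioc 0 T = ∅ := by
      ext y; simp only [mem_inter_iff, mem_compl_iff, mem_Icc, mem_Ioc, mem_empty_iff_false]
      exact ⟨fun h => h.1 ⟨h.2.1.le, h.2.2⟩, False.elim⟩
    rw [Measure.add_apply, Measure.restrict_apply measurableSet_Icc.compl, this]
    simp [hT]
  have fin : ∀ (F : StieltjesFunction ℝ) (c : ℝ),
      IsFiniteMeasure (c.toNNReal • Measure.dirac (0 : ℝ) + F.measure.restrict (Ioc 0 T)) :=
    fun F c => by
    have : IsFiniteMeasure (F.measure.restrict (Ioc 0 T)) :=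
      ⟨by rw [Measure.restrict_apply_univ, StieltjesFunction.measure_Ioc]; finiteness⟩
    infer_instance
  have huniv : ∀ ν : Measure ℝ, ν (Icc 0 T)ᶜ = 0 → ν.real univ = ν.real (Icc 0 T) := fun ν hν => by
    simp only [measureReal_def]
    congr 1
    rw [← univ_inter (Icc 0 T), measure_inter_conull hν]
  have hmax : max (v 0) 0 - max (-v 0) 0 = v 0 ∧ max (v 0) 0 + max (-v 0) 0 = |v 0| := by
    rcases le_total 0 (v 0) with h | h
    · rw [max_eq_left h, max_eq_right (by linarith), abs_of_nonneg h]; simp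
    · rw [max_eq_right h, max_eq_left (by linarith), abs_of_nonpos h]; simp
  refine ⟨_, _, ⟨fin P (v 0), fin Q (-v 0), nul P _, nul Q _, fun t ht => ?_⟩, ?_⟩
  · rw [meas _ _ t ht, meas _ _ t ht]
    linarith [hPQ t ht, hPQ 0 h0]
  · rw [huniv _ (nul P _), huniv _ (nul Q _), meas _ _ T hTm, meas _ _ T hTm]
    have hd := hv.dist_le h0 hTm
    rw [Real.dist_eq] at hd
    linarith [hPQ T hTm, hPQ 0 h0, (abs_le.1 hd).2]

lemma integral_measure_Iic_eq (α ν : Measure ℝ) [IsFiniteMeasure α] [IsFiniteMeasure ν] :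
    ∫ t, α.real (Iic t) ∂ν = ∫ s, ν.real (Ici s) ∂α := by
  have hE : MeasurableSet {p : ℝ × ℝ | p.1 ≤ p.2} := measurableSet_le measurable_fst measurable_snd
  have h1 := Measure.prod_apply (μ := α) (ν := ν) hE
  have h2 := Measure.prod_apply_symm (μ := α) (ν := ν) hE
  have m1 : Monotone fun t => α (Iic t) := fun s t hst => measure_mono (Iic_subset_Iic.2 hst)
  have m2 : Antitone fun s => ν (Ici s) := fun s t hst => measure_mono (Ici_subset_Ici.2 hst)
  simp only [measureReal_def]
  rw [integral_toReal m1.measurable.aemeasurable (ae_of_all _ fun t => measure_lt_top _ _),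
    integral_toReal m2.measurable.aemeasurable (ae_of_all _ fun t => measure_lt_top _ _)]
  congr 1
  exact h2.symm.trans h1

lemma RepPair.real_Iic {T : ℝ} {ν₁ ν₂ : Measure ℝ} {v : ℝ → ℝ} (h : RepPair T ν₁ ν₂ v) {t : ℝ}
    (ht : t ∈ Icc 0 T) : ν₁.real (Iic t) - ν₂.real (Iic t) = v t := by
  rw [← h.eq t ht, measureReal_def, measureReal_def, measure_Iic_eq_Icc h.null₁,
    measure_Iic_eq_Icc h.null₂, min_eq_left ht.2]
  rfl

lemma RepPair.real_Ici {T : ℝ} {ν₁ ν₂ : Measure ℝ} {A : ℝ → ℝ} (h : RepPair T ν₁ ν₂ A)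
    (hA : Continuous A) (hA0 : A 0 = 0) {s : ℝ} (hs : s ∈ Icc 0 T) :
    ν₁.real (Ici s) - ν₂.real (Ici s) = A T - A s := by
  have := h.fin₁
  have := h.fin₂
  have hT : T ∈ Icc 0 T := ⟨hs.1.trans hs.2, le_rfl⟩
  have huniv : ∀ ν : Measure ℝ, ν (Icc 0 T)ᶜ = 0 → ν.real univ = ν.real (Iic T) := fun ν hν => by
    simp only [measureReal_def]
    rw [measure_Iic_eq_Icc hν, min_self, ← univ_inter (Icc 0 T), measure_inter_conull hν]
  have hIio : ν₁.real (Iio s) - ν₂.real (Iio s) = A s := by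
    obtain ⟨u, hu, hus, hut⟩ := exists_seq_strictMono_tendsto s
    have hU : ⋃ k, Iic (u k) = Iio s := iUnion_Iic_eq_Iio_of_lt_of_tendsto hus hut
    have hlim : ∀ ν : Measure ℝ, IsFiniteMeasure ν →
        Tendsto (fun k => ν.real (Iic (u k))) atTop (𝓝 (ν.real (Iio s))) := fun ν _ => by
      have := tendsto_measure_iUnion_atTop (μ := ν) (s := fun k => Iic (u k))
        (fun i j hij => Iic_subset_Iic.2 (hu.monotone hij))
      rw [hU] at this
      exact (ENNReal.tendsto_toReal (by finiteness)).comp this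
    refine tendsto_nhds_unique ((hlim ν₁ h.fin₁).sub (hlim ν₂ h.fin₂)) ?_
    have hc : Tendsto (fun k => A (max 0 (u k))) atTop (𝓝 (A s)) := by
      have : Continuous fun y => A (max 0 y) := by fun_prop
      have h2 := (this.tendsto s).comp hut
      rwa [max_eq_right hs.1] at h2
    refine hc.congr fun k => ?_
    rcases le_or_gt 0 (u k) with hk | hk
    · rw [max_eq_right hk, h.real_Iic ⟨hk, (hus k).le.trans hs.2⟩]
    · rw [max_eq_left hk.le, hA0, measureReal_def, measureReal_def, measure_Iic_eq_Icc h.null₁,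
        measure_Iic_eq_Icc h.null₂, Icc_eq_empty (by simp [hk])]
      simp
  have hcompl : ∀ ν : Measure ℝ, IsFiniteMeasure ν → ν.real (Ici s) = ν.real univ - ν.real (Iio s) :=
    fun ν _ => by rw [← measureReal_compl measurableSet_Iio, compl_Iio]
  rw [hcompl ν₁ h.fin₁, hcompl ν₂ h.fin₂, huniv _ h.null₁, huniv _ h.null₂]
  linarith [h.real_Iic hT]

lemma RepPair.finIntegrable {T : ℝ} {ν₁ ν₂ : Measure ℝ} {v : ℝ → ℝ} (h : RepPair T ν₁ ν₂ v) :
    FinIntegrable T v := by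
  have := h.fin₁
  have := h.fin₂
  have m : ∀ ν : Measure ℝ, IsFiniteMeasure ν → Measurable fun t => ν.real (Iic t) := fun ν _ =>
    Monotone.measurable fun s t hst => measureReal_mono (Iic_subset_Iic.2 hst)
  refine finIntegrable_of_bounded (C := ν₁.real univ + ν₂.real univ)
    ((m ν₁ h.fin₁).sub (m ν₂ h.fin₂)) (fun t ht => (h.real_Iic ht).symm) fun t ht => ?_
  rw [← h.real_Iic ht]
  have a1 : ν₁.real (Iic t) ≤ ν₁.real univ := measureReal_mono (subset_univ _)
  have a2 : ν₂.real (Iic t) ≤ ν₂.real univ := measureReal_mono (subset_univ _)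
  have a3 : 0 ≤ ν₁.real (Iic t) := measureReal_nonneg
  have a4 : 0 ≤ ν₂.real (Iic t) := measureReal_nonneg
  exact abs_le.2 ⟨by linarith, by linarith⟩

/-- Integration by parts against a continuous integrator. -/
lemma intD_by_parts {T : ℝ} {α₁ α₂ ν₁ ν₂ : Measure ℝ} {v A : ℝ → ℝ} (hv : RepPair T α₁ α₂ v)
    (h : RepPair T ν₁ ν₂ A) (hA : Continuous A) (hA0 : A 0 = 0) :
    intD T v A = intD T (fun s => A T - A s) v := by
  have := h.fin₁
  have := h.fin₂
  have := hv.fin₁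
  have := hv.fin₂
  have i1 : ∀ α ν : Measure ℝ, IsFiniteMeasure α → IsFiniteMeasure ν →
      Integrable (fun t => α.real (Iic t)) ν := fun α ν _ _ =>
    Integrable.of_bound (C := α.real univ) (Monotone.measurable fun s t hst =>
      measureReal_mono (Iic_subset_Iic.2 hst)).aestronglyMeasurable (ae_of_all _ fun t => by
        rw [Real.norm_of_nonneg measureReal_nonneg]; exact measureReal_mono (subset_univ _))
  have i2 : ∀ α ν : Measure ℝ, IsFiniteMeasure α → IsFiniteMeasure ν →
      Integrable (fun t => α.real (Ici t)) ν := fun α ν _ _ =>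
    Integrable.of_bound (C := α.real univ) (Antitone.measurable fun s t hst =>
      measureReal_mono (Ici_subset_Ici.2 hst)).aestronglyMeasurable (ae_of_all _ fun t => by
        rw [Real.norm_of_nonneg measureReal_nonneg]; exact measureReal_mono (subset_univ _))
  rw [h.intD_eq hv.finIntegrable,
    hv.intD_eq (Continuous.finIntegrable (f := fun s => A T - A s) (by fun_prop) T)]
  have e1 : ∀ ν : Measure ℝ, IsFiniteMeasure ν → ν (Icc 0 T)ᶜ = 0 →
      ∫ t, v t ∂ν = ∫ s, ν.real (Ici s) ∂α₁ - ∫ s, ν.real (Ici s) ∂α₂ := fun ν _ hν => by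
    rw [RepPair.integral_congr hν fun t ht => (hv.real_Iic ht).symm,
      integral_sub (i1 _ _ hv.fin₁ ‹_›) (i1 _ _ hv.fin₂ ‹_›), integral_measure_Iic_eq,
      integral_measure_Iic_eq]
  have e2 : ∀ α : Measure ℝ, IsFiniteMeasure α → α (Icc 0 T)ᶜ = 0 →
      ∫ s, (A T - A s) ∂α = ∫ s, ν₁.real (Ici s) ∂α - ∫ s, ν₂.real (Ici s) ∂α := fun α _ hα => by
    rw [RepPair.integral_congr hα fun t ht => (h.real_Ici hA hA0 ht).symm,
      integral_sub (i2 _ _ h.fin₁ ‹_›) (i2 _ _ h.fin₂ ‹_›)]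
  rw [e1 _ h.fin₁ h.null₁, e1 _ h.fin₂ h.null₂, e2 _ hv.fin₁ hv.null₁, e2 _ hv.fin₂ hv.null₂]
  ring

/-- The step function with jumps `a k` at the points `τ k`. -/
def stepFun {B : ℕ} (a τ : Fin B → ℝ) (t : ℝ) : ℝ := ∑ k, a k * (if τ k ≤ t then 1 else 0)

/-- `x` is `ε`-approximated on `[s,T]` by a step function with `B` jumps bounded by `C`. -/
def StepApprox (s T ε : ℝ) (x : ℝ → ℝ) (B : ℕ) (C : ℝ) : Prop :=
  ∃ a τ : Fin B → ℝ, (∀ k, |a k| ≤ C) ∧ (∀ k, τ k ∈ Icc s T) ∧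
    ∀ t ∈ Icc s T, |x t - stepFun a τ t| ≤ ε

/-- `x` has `K` consecutive increments of size at least `ε` on `[s,T]`, starting at `s`. -/
def HasChain (s T ε : ℝ) (x : ℝ → ℝ) (K : ℕ) : Prop :=
  ∃ p : ℕ → ℝ, p 0 = s ∧ ∀ i < K, p i < p (i + 1) ∧ p (i + 1) ≤ T ∧ ε ≤ |x (p (i + 1)) - x (p i)|

lemma stepFun_cons {B : ℕ} (a τ : Fin B → ℝ) (b s t : ℝ) :
    stepFun (Fin.cons b a : Fin (B + 1) → ℝ) (Fin.cons s τ : Fin (B + 1) → ℝ) t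
      = b * (if s ≤ t then 1 else 0) + stepFun a τ t := by
  simp [stepFun, Fin.sum_univ_succ]

lemma abs_stepFun_le {B : ℕ} (a τ : Fin B → ℝ) {C : ℝ} (h : ∀ k, |a k| ≤ C) (t : ℝ) :
    |stepFun a τ t| ≤ B * C := by
  refine (Finset.abs_sum_le_sum_abs _ _).trans ?_
  calc _ ≤ ∑ _k : Fin B, C := Finset.sum_le_sum fun k _ => by
        split_ifs
        · simpa using h k
        · simpa using (abs_nonneg _).trans (h k)
    _ = _ := by simp

lemma StepApprox.mono {s T ε : ℝ} {x : ℝ → ℝ} {B B' : ℕ} {C C' : ℝ} (hsT : s ≤ T) (hC : 0 ≤ C)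
    (h : StepApprox s T ε x B C) (hB : B ≤ B') (hCC : C ≤ C') : StepApprox s T ε x B' C' := by
  induction B', hB using Nat.le_induction with
  | base =>
    obtain ⟨a, τ, h1, h2, h3⟩ := h
    exact ⟨a, τ, fun k => (h1 k).trans hCC, h2, h3⟩
  | succ n _ ih =>
    obtain ⟨a, τ, h1, h2, h3⟩ := ih
    refine ⟨Fin.cons 0 a, Fin.cons s τ, ?_, ?_, fun t ht => ?_⟩
    · exact Fin.cases (by simpa using hC.trans hCC) (by simpa using h1)
    · exact Fin.cases (by simpa using hsT) (fun k => by simpa using h2 k)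
    · rw [stepFun_cons]
      simpa using h3 t ht

lemma StepApprox.of_const {s T ε : ℝ} {x : ℝ → ℝ} {C : ℝ} (hsT : s ≤ T) (hC : |x s| ≤ C)
    (h : ∀ t ∈ Icc s T, |x t - x s| ≤ ε) : StepApprox s T ε x 1 C :=
  ⟨fun _ => x s, fun _ => s, fun _ => hC, fun _ => ⟨le_rfl, hsT⟩, fun t ht => by
    simpa [stepFun, ht.1] using h t ht⟩

lemma StepApprox.extend {s u T ε : ℝ} {x : ℝ → ℝ} {B : ℕ} {C : ℝ} (hsu : s < u) (huT : u ≤ T)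
    (hC : |x s| ≤ C) (h : ∀ t ∈ Ico s u, |x t - x s| ≤ ε) (hx : StepApprox u T ε x B C) :
    StepApprox s T ε x (B + 2) C := by
  obtain ⟨a, τ, h1, h2, h3⟩ := hx
  refine ⟨Fin.cons (x s) (Fin.cons (-x s) a : Fin (B + 1) → ℝ),
    Fin.cons s (Fin.cons u τ : Fin (B + 1) → ℝ), ?_, ?_, fun t ht => ?_⟩
  · exact Fin.cases (by simpa using hC) (Fin.cases (by simpa using hC) (by simpa using h1))
  · refine Fin.cases (by simpa using hsu.le.trans huT) (Fin.cases ?_ fun k => ?_)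
    · simpa using ⟨hsu.le, huT⟩
    · simpa using ⟨hsu.le.trans (h2 k).1, (h2 k).2⟩
  · rw [stepFun_cons, stepFun_cons, if_pos ht.1]
    rcases lt_or_ge t u with htu | hut
    · have hz : stepFun a τ t = 0 := Finset.sum_eq_zero fun k _ => by
        rw [if_neg (not_le.2 (htu.trans_le (h2 k).1)), mul_zero]
      rw [if_neg (not_le.2 htu), hz]
      simpa using h t ⟨ht.1, htu⟩
    · rw [if_pos hut]
      have := h3 t ⟨hut, ht.2⟩
      simpa using this

lemma CadlagInf.exists_next {x : ℝ → ℝ} (hx : CadlagInf x) {s T ε : ℝ} (hs : 0 ≤ s) (hε : 0 < ε) :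
    (∀ t ∈ Icc s T, |x t - x s| ≤ ε) ∨
      ∃ u, s < u ∧ u ≤ T ∧ ε ≤ |x u - x s| ∧ ∀ t ∈ Ico s u, |x t - x s| ≤ ε := by
  by_cases hE : ∀ t ∈ Icc s T, |x t - x s| ≤ ε
  · exact Or.inl hE
  right
  push Not at hE
  set E : Set ℝ := {t | t ∈ Icc s T ∧ ε < |x t - x s|} with hEdef
  obtain ⟨t₀, ht₀, ht₀'⟩ := hE
  have hne : E.Nonempty := ⟨t₀, ht₀, ht₀'⟩
  have hbdd : BddBelow E := ⟨s, fun t ht => ht.1.1⟩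
  have gap : ∀ r, 0 ≤ r → |x r - x s| < ε → (∀ t ∈ E, r ≤ t) → r < sInf E := fun r hr hrε hlb => by
    have hlim : Tendsto (fun t => |x t - x s|) (𝓝[>] r) (𝓝 |x r - x s|) :=
      ((hx.1 r hr).sub_const _).abs
    obtain ⟨w, hw, hsub⟩ := mem_nhdsGT_iff_exists_Ioo_subset.1 (hlim (Iio_mem_nhds hrε))
    refine lt_of_lt_of_le hw (le_csInf hne fun t ht => ?_)
    by_contra hlt
    rcases (hlb t ht).eq_or_lt with rfl | hrt
    · exact absurd ht.2 (not_lt.2 hrε.le)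
    · exact absurd (hsub ⟨hrt, not_le.1 hlt⟩) (not_lt.2 ht.2.le)
  have hsu : s < sInf E := gap s hs (by simpa using hε) fun t ht => ht.1.1
  refine ⟨sInf E, hsu, (csInf_le hbdd ⟨ht₀, ht₀'⟩).trans ht₀.2, ?_, fun t ht => ?_⟩
  · by_contra hlt
    exact lt_irrefl _ (gap (sInf E) (hs.trans hsu.le) (not_le.1 hlt) fun t ht => csInf_le hbdd ht)
  · by_contra hlt
    exact notMem_of_lt_csInf ht.2 hbdd ⟨⟨ht.1, ht.2.le.trans
      ((csInf_le hbdd ⟨ht₀, ht₀'⟩).trans ht₀.2)⟩, not_le.1 hlt⟩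

lemma CadlagInf.exists_stepApprox {x : ℝ → ℝ} (hx : CadlagInf x) {T ε : ℝ} (hT : 0 ≤ T)
    (hε : 0 < ε) : ∃ B C, 0 ≤ C ∧ StepApprox 0 T ε x B C := by
  by_contra hcon
  set bad : Set ℝ := {s | s ∈ Icc 0 T ∧ ¬ ∃ B C, 0 ≤ C ∧ StepApprox s T ε x B C} with hbad
  have next : ∀ s : bad, ∃ u : bad, (s : ℝ) < u ∧ ε ≤ |x u - x s| := by
    rintro ⟨s, hs, hs'⟩
    rcases hx.exists_next (T := T) hs.1 hε with h | ⟨u, hsu, huT, huε, h⟩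
    · exact absurd ⟨1, |x s|, abs_nonneg _, StepApprox.of_const hs.2 le_rfl h⟩ hs'
    · refine ⟨⟨u, ⟨hs.1.trans hsu.le, huT⟩, ?_⟩, hsu, huε⟩
      rintro ⟨B, C, hC, hBC⟩
      exact hs' ⟨B + 2, max |x s| C, hC.trans (le_max_right _ _), StepApprox.extend hsu huT
        (le_max_left _ _) h (hBC.mono huT hC le_rfl (le_max_right _ _))⟩
  choose f hf1 hf2 using next
  set p : ℕ → bad := fun n => f^[n] ⟨0, ⟨le_rfl, hT⟩, hcon⟩ with hp
  have hps : ∀ n, p (n + 1) = f (p n) := fun n => Function.iterate_succ_apply' f n _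
  have hmono : StrictMono fun n => (p n : ℝ) := strictMono_nat_of_lt_succ fun n => by
    rw [hps]; exact hf1 _
  have hbdd : BddAbove (range fun n => (p n : ℝ)) := ⟨T, by rintro _ ⟨n, rfl⟩; exact (p n).2.1.2⟩
  set L := ⨆ n, (p n : ℝ) with hL
  have hlim : Tendsto (fun n => (p n : ℝ)) atTop (𝓝 L) := tendsto_atTop_ciSup hmono.monotone hbdd
  have hlt : ∀ n, (p n : ℝ) < L := fun n =>
    (hmono (Nat.lt_succ_self n)).trans_le (le_ciSup hbdd (n + 1))
  obtain ⟨l, hl⟩ := hx.2 L ((p 0).2.1.1.trans_lt (hlt 0))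
  have hxl : Tendsto (fun n => x (p n)) atTop (𝓝 l) :=
    hl.comp (tendsto_nhdsWithin_iff.2 ⟨hlim, Eventually.of_forall hlt⟩)
  have hdiff : Tendsto (fun n => |x (p (n + 1)) - x (p n)|) atTop (𝓝 0) := by
    simpa using ((hxl.comp (tendsto_add_atTop_nat 1)).sub hxl).abs
  obtain ⟨n, hn⟩ := (hdiff.eventually (Iio_mem_nhds hε)).exists
  have := hf2 (p n)
  rw [← hps] at this
  exact absurd this (not_le.2 hn)

lemma CadlagInf.stepApprox_or_hasChain {x : ℝ → ℝ} (hx : CadlagInf x) {T ε C : ℝ} (hε : 0 < ε)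
    (hC0 : 0 ≤ C) (hC : ∀ t ∈ Icc 0 T, |x t| ≤ C) (K : ℕ) :
    ∀ s ∈ Icc 0 T, StepApprox s T ε x (2 * K) C ∨ HasChain s T ε x K := by
  induction K with
  | zero => exact fun s _ => Or.inr ⟨fun _ => s, rfl, fun i hi => absurd hi (Nat.not_lt_zero i)⟩
  | succ K ih =>
    intro s hs
    rcases hx.exists_next (T := T) hs.1 hε with h | ⟨u, hsu, huT, huε, h⟩
    · exact Or.inl ((StepApprox.of_const hs.2 (hC s hs) h).mono hs.2 hC0 (by lia) le_rfl)
    · rcases ih u ⟨hs.1.trans hsu.le, huT⟩ with h' | ⟨p, hp0, hp⟩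
      · exact Or.inl (StepApprox.extend hsu huT (hC s hs) h h')
      · refine Or.inr ⟨fun i => Nat.casesOn i s p, rfl, fun i hi => ?_⟩
        cases i with
        | zero => simpa [hp0] using ⟨hsu, huT, huε⟩
        | succ i => exact hp i (by lia)

lemma CadlagInf.exists_bound {x : ℝ → ℝ} (hx : CadlagInf x) (T : ℝ) :
    ∃ C, ∀ t ∈ Icc 0 T, |x t| ≤ C := by
  rcases lt_or_ge T 0 with hT | hT
  · exact ⟨0, fun t ht => absurd (ht.1.trans ht.2) (not_le.2 hT)⟩
  obtain ⟨B, C, -, a, τ, h1, -, h3⟩ := hx.exists_stepApprox hT one_pos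
  refine ⟨1 + B * C, fun t ht => ?_⟩
  calc |x t| = |(x t - stepFun a τ t) + stepFun a τ t| := by ring_nf
    _ ≤ _ := (abs_add_le _ _).trans (add_le_add (h3 t ht) (abs_stepFun_le a τ h1 t))

lemma CadlagInf.finIntegrable {x : ℝ → ℝ} (hx : CadlagInf x) (T : ℝ) : FinIntegrable T x := by
  obtain ⟨C, hC⟩ := hx.exists_bound T
  set y : ℝ → ℝ := (Ici 0).indicator x with hy
  have hym : Measurable y := by
    have hn : ∀ n : ℕ, Measurable fun t : ℝ => y ((⌊(n + 1) * t⌋ + 1 : ℤ) / (n + 1 : ℝ)) := fun n =>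
      (measurable_from_top (f := fun k : ℤ => y ((k + 1 : ℤ) / (n + 1 : ℝ)))).comp
        (Int.measurable_floor.comp (measurable_const_mul _))
    refine measurable_of_tendsto_metrizable hn (tendsto_pi_nhds.2 fun t => ?_)
    have hyr : Tendsto y (𝓝[>] t) (𝓝 (y t)) := by
      rcases lt_or_ge t 0 with ht | ht
      · have : y t = 0 := indicator_of_notMem (by simpa using ht) _
        rw [this]
        refine tendsto_const_nhds.congr' ?_
        filter_upwards [Ioo_mem_nhdsGT ht] with s hs
        exact (indicator_of_notMem (by simpa using hs.2) _).symm
      · have : y t = x t := indicator_of_mem (by simpa using ht) _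
        rw [this]
        refine (hx.1 t ht).congr' ?_
        filter_upwards [self_mem_nhdsWithin] with s hs
        exact (indicator_of_mem (show s ∈ Ici 0 from ht.trans (le_of_lt hs)) _).symm
    refine hyr.comp (tendsto_nhdsWithin_iff.2 ⟨?_, Eventually.of_forall fun n => ?_⟩)
    · have hup : Tendsto (fun n : ℕ => t + 1 / ((n : ℝ) + 1)) atTop (𝓝 t) := by
        simpa using tendsto_one_div_add_atTop_nhds_zero_nat.const_add t
      refine tendsto_of_tendsto_of_tendsto_of_le_of_le tendsto_const_nhds hup (fun n => ?_)
        fun n => ?_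
      · have hpos : (0 : ℝ) < n + 1 := by positivity
        simp only
        rw [le_div_iff₀ hpos]
        push_cast
        linarith [Int.lt_floor_add_one (((n : ℝ) + 1) * t)]
      · have hpos : (0 : ℝ) < n + 1 := by positivity
        simp only
        rw [div_le_iff₀ hpos, add_mul t, one_div, inv_mul_cancel₀ hpos.ne']
        push_cast
        linarith [Int.floor_le (((n : ℝ) + 1) * t)]
    · have hpos : (0 : ℝ) < n + 1 := by positivity
      rw [mem_Ioi, lt_div_iff₀ hpos]
      push_cast
      linarith [Int.lt_floor_add_one (((n : ℝ) + 1) * t)]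
  exact finIntegrable_of_bounded hym
    (fun t ht => (indicator_of_mem (show t ∈ Ici 0 from ht.1) _).symm) hC

/-- The uniform probability measure on `(t, t + δ]`. -/
def avgMeas (t δ : ℝ) : Measure ℝ := (δ⁻¹).toNNReal • volume.restrict (Ioc t (t + δ))

/-- The distribution function of `avgMeas t δ`. -/
def ramp (t δ r : ℝ) : ℝ := δ⁻¹ * max 0 (min δ (r - t))

instance (t δ : ℝ) : IsFiniteMeasure (avgMeas t δ) := by
  unfold avgMeas; infer_instance

lemma avgMeas_real_Icc {t δ : ℝ} (ht : 0 ≤ t) (hδ : 0 < δ) (r : ℝ) :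
    (avgMeas t δ).real (Icc 0 r) = ramp t δ r := by
  have h : Icc 0 r ∩ Ioc t (t + δ) = Ioc t (min (t + δ) r) := by
    ext y; simp only [mem_inter_iff, mem_Icc, mem_Ioc, le_min_iff]
    exact ⟨fun h => ⟨h.2.1, h.2.2, h.1.2⟩, fun h => ⟨⟨ht.trans h.1.le, h.2.2⟩, h.1, h.2.1⟩⟩
  rw [avgMeas, measureReal_nnreal_smul_apply, measureReal_restrict_apply measurableSet_Icc, h,
    Real.volume_real_Ioc, Real.coe_toNNReal _ (inv_nonneg.2 hδ.le), ramp, max_comm]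
  congr 2
  rw [← min_sub_sub_right]
  ring_nf

lemma avgMeas_null {t δ T : ℝ} (ht : 0 ≤ t) (htT : t + δ ≤ T) : avgMeas t δ (Icc 0 T)ᶜ = 0 := by
  have h : (Icc 0 T)ᶜ ∩ Ioc t (t + δ) = ∅ := by
    ext y; simp only [mem_inter_iff, mem_compl_iff, mem_Icc, mem_Ioc, mem_empty_iff_false]
    exact ⟨fun h => h.1 ⟨ht.trans h.2.1.le, h.2.2.trans htT⟩, False.elim⟩
  simp [avgMeas, Measure.restrict_apply measurableSet_Icc.compl, h]

lemma avgMeas_real_univ {t δ : ℝ} (hδ : 0 < δ) : (avgMeas t δ).real univ = 1 := by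
  rw [avgMeas, measureReal_nnreal_smul_apply, measureReal_restrict_apply MeasurableSet.univ,
    univ_inter, Real.volume_real_Ioc, Real.coe_toNNReal _ (inv_nonneg.2 hδ.le)]
  simp [hδ.le, hδ.ne']

lemma ae_avgMeas {t δ : ℝ} : ∀ᵐ s ∂avgMeas t δ, s ∈ Ioc t (t + δ) :=
  Measure.ae_smul_measure (ae_restrict_mem measurableSet_Ioc) _

lemma abs_integral_avgMeas_sub_le {t δ : ℝ} (hδ : 0 < δ) {f : ℝ → ℝ}
    (hf : Integrable f (avgMeas t δ)) {c ε : ℝ} (h : ∀ s ∈ Ioc t (t + δ), |f s - c| ≤ ε) :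
    |∫ s, f s ∂avgMeas t δ - c| ≤ ε := by
  have e : ∫ s, f s ∂avgMeas t δ - c = ∫ s, (f s - c) ∂avgMeas t δ := by
    rw [integral_sub hf (integrable_const _), integral_const, avgMeas_real_univ hδ, one_smul]
  have := norm_integral_le_of_norm_le_const (f := fun s => f s - c) (C := ε)
    (ae_avgMeas.mono h)
  rwa [← e, avgMeas_real_univ hδ, mul_one, Real.norm_eq_abs] at this

lemma eventually_abs_integral_avgMeas_sub_le {f : ℝ → ℝ} {t : ℝ} (ht : 0 ≤ t)
    (hf : FinIntegrable (t + 1) f) (hr : Tendsto f (𝓝[>] t) (𝓝 (f t))) {ε : ℝ} (hε : 0 < ε) :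
    ∀ᶠ δ in 𝓝[>] (0 : ℝ), |∫ s, f s ∂avgMeas t δ - f t| ≤ ε := by
  obtain ⟨w, hw, hsub⟩ := mem_nhdsGT_iff_exists_Ioo_subset.1 (hr (Metric.closedBall_mem_nhds _ hε))
  have hpos : 0 < min 1 (w - t) := lt_min one_pos (sub_pos.2 hw)
  filter_upwards [Ioo_mem_nhdsGT hpos] with δ hδ
  have h1 : δ < 1 := hδ.2.trans_le (min_le_left _ _)
  have h2 : δ < w - t := hδ.2.trans_le (min_le_right _ _)
  refine abs_integral_avgMeas_sub_le hδ.1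
    (hf _ inferInstance (avgMeas_null ht (by linarith))) fun s hs => ?_
  exact hsub ⟨hs.1, by linarith [hs.2]⟩

lemma ramp_mem {t δ r : ℝ} (hδ : 0 < δ) : 0 ≤ ramp t δ r ∧ ramp t δ r ≤ 1 := by
  refine ⟨mul_nonneg (inv_nonneg.2 hδ.le) (le_max_left _ _), ?_⟩
  rw [ramp, inv_mul_le_iff₀ hδ, mul_one]
  exact max_le hδ.le (min_le_left _ _)

lemma ramp_anti {t t' δ : ℝ} (hδ : 0 < δ) (h : t ≤ t') (r : ℝ) : ramp t' δ r ≤ ramp t δ r :=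
  mul_le_mul_of_nonneg_left (max_le_max_left _ (min_le_min_left _ (by linarith)))
    (inv_nonneg.2 hδ.le)

/-- A linear combination of ramps. -/
def rampSum {ι : Type*} [Fintype ι] (c q : ι → ℝ) (δ r : ℝ) : ℝ := ∑ i, c i * ramp (q i) δ r

section rampSum

variable {ι : Type*} [Fintype ι] {c q : ι → ℝ} {δ T : ℝ}

lemma rampSum_repPair (hδ : 0 < δ) (hq : ∀ i, 0 ≤ q i ∧ q i + δ ≤ T) :
    RepPair T (∑ i, (c i).toNNReal • avgMeas (q i) δ) (∑ i, (-c i).toNNReal • avgMeas (q i) δ)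
      (rampSum c q δ) :=
  RepPair.sum c _ (fun i => avgMeas_null (hq i).1 (hq i).2) fun t _ =>
    Finset.sum_congr rfl fun i _ => by rw [avgMeas_real_Icc (hq i).1 hδ]

lemma intD_rampSum (hδ : 0 < δ) (hq : ∀ i, 0 ≤ q i ∧ q i + δ ≤ T) {f : ℝ → ℝ}
    (hf : FinIntegrable T f) :
    intD T f (rampSum c q δ) = ∑ i, c i * ∫ t, f t ∂avgMeas (q i) δ :=
  intD_sum c _ (fun i => avgMeas_null (hq i).1 (hq i).2) (fun t _ =>
    Finset.sum_congr rfl fun i _ => by rw [avgMeas_real_Icc (hq i).1 hδ]) hf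

lemma eVariationOn_rampSum (hT : 0 ≤ T) (hδ : 0 < δ) (hq : ∀ i, 0 ≤ q i ∧ q i + δ ≤ T) :
    eVariationOn (rampSum c q δ) (Icc 0 T) ≤ ENNReal.ofReal (∑ i, |c i|) := by
  refine ((rampSum_repPair hδ hq).eVariationOn_le hT).trans (ENNReal.ofReal_le_ofReal (le_of_eq ?_))
  have key : ∀ d : ι → ℝ, (∑ i, (d i).toNNReal • avgMeas (q i) δ).real univ = ∑ i, max (d i) 0 :=
    fun d => by
    simp only [measureReal_def, Measure.coe_finsetSum, Finset.sum_apply]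
    rw [ENNReal.toReal_sum (by intro i _; finiteness)]
    refine Finset.sum_congr rfl fun i _ => ?_
    have := avgMeas_real_univ (t := q i) hδ
    rw [measureReal_def] at this
    simp [this]
  rw [key, key, ← Finset.sum_add_distrib]
  refine Finset.sum_congr rfl fun i _ => ?_
  rcases le_total 0 (c i) with h | h
  · rw [max_eq_left h, max_eq_right (by linarith), abs_of_nonneg h]; simp
  · rw [max_eq_right h, max_eq_left (by linarith), abs_of_nonpos h]; simp

lemma memA_rampSum (hT : 0 ≤ T) (hδ : 0 < δ) (hq : ∀ i, 0 ≤ q i ∧ q i + δ ≤ T) :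
    MemA T (rampSum c q δ) := by
  refine ⟨?_, ((eVariationOn_rampSum hT hδ hq).trans_lt ENNReal.ofReal_lt_top).ne, ?_⟩
  · have : Continuous (rampSum c q δ) := by unfold rampSum ramp; fun_prop
    exact this.continuousOn
  · refine Finset.sum_eq_zero fun i _ => ?_
    rw [ramp, max_eq_left, mul_zero, mul_zero]
    exact (min_le_right _ _).trans (by linarith [(hq i).1])

end rampSum

lemma intD_zero (T : ℝ) {f : ℝ → ℝ} (hf : FinIntegrable T f) : intD T f (fun _ => 0) = 0 := by
  have h : RepPair T 0 0 (fun _ => (0 : ℝ)) :=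
    ⟨inferInstance, inferInstance, rfl, rfl, fun t _ => by simp⟩
  rw [h.intD_eq hf]
  simp

/-- Integrators of bounded variation that tend uniformly to zero along a subsequence cannot produce
integrals bounded away from zero. -/
lemma SStarConvInf.not_frequently {x : ℕ → ℝ → ℝ} {x₀ : ℝ → ℝ} (H : SStarConvInf x x₀)
    (hx₀ : CadlagInf x₀) {T M c : ℝ} (hT : 0 < T) (hc : 0 < c) :
    ¬ ∀ k : ℕ, ∃ᶠ n in atTop, ∃ A, MemA T A ∧ eVariationOn A (Icc 0 T) ≤ ENNReal.ofReal M ∧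
      (∀ t ∈ Icc 0 T, |A t| ≤ 1 / ((k : ℝ) + 1)) ∧ c ≤ |intD T (x n) A| := by
  intro hP
  obtain ⟨φ, hφ, hA⟩ := extraction_forall_of_frequently hP
  choose A hA1 hA2 hA3 hA4 using hA
  classical
  set D : ℕ → ℝ → ℝ := fun n => if h : ∃ k, φ k = n then A h.choose else fun _ => 0 with hD
  have hDφ : ∀ k, D (φ k) = A k := fun k => by
    have h : ∃ j, φ j = φ k := ⟨k, rfl⟩
    simp only [hD]
    rw [dif_pos h, hφ.injective h.choose_spec]
  have hcases : ∀ n, (∃ k, φ k = n ∧ D n = A k) ∨ D n = fun _ => 0 := fun n => by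
    by_cases h : ∃ k, φ k = n
    · obtain ⟨k, rfl⟩ := h
      exact Or.inl ⟨k, rfl, hDφ k⟩
    · exact Or.inr (by simp only [hD]; rw [dif_neg h])
  have hvar0 : eVariationOn (fun _ : ℝ => (0 : ℝ)) (Icc 0 T) = 0 :=
    eVariationOn.constant_on (by
      rintro _ ⟨_, _, rfl⟩ _ ⟨_, _, rfl⟩; rfl)
  have hmem0 : MemA T (fun _ => (0 : ℝ)) :=
    ⟨continuousOn_const, by rw [BoundedVariationOn, hvar0]; simp, rfl⟩
  have hlim := H T hT D (fun _ => 0) (fun n => by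
      rcases hcases n with ⟨k, -, h⟩ | h
      · rw [h]; exact hA1 k
      · rw [h]; exact hmem0) hmem0 ⟨by
      rw [Metric.tendstoUniformlyOn_iff]
      intro ε hε
      obtain ⟨k₀, hk₀⟩ := exists_nat_one_div_lt hε
      filter_upwards [eventually_ge_atTop (φ k₀)] with n hn t ht
      rw [dist_comm, Real.dist_eq, sub_zero]
      rcases hcases n with ⟨k, rfl, h⟩ | h
      · rw [h]
        have hk : (k₀ : ℝ) ≤ k := by exact_mod_cast hφ.le_iff_le.1 hn
        refine (hA3 k t ht).trans_lt (lt_of_le_of_lt ?_ hk₀)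
        exact one_div_le_one_div_of_le (by positivity) (by linarith)
      · rw [h]; simpa using hε, M, fun n => by
      rcases hcases n with ⟨k, -, h⟩ | h
      · rw [h]; exact hA2 k
      · rw [h, hvar0]; exact zero_le⟩
  rw [intD_zero T (hx₀.finIntegrable T)] at hlim
  have hlim2 := (hlim.comp hφ.tendsto_atTop).abs
  rw [abs_zero] at hlim2
  obtain ⟨k, hk⟩ := (hlim2.eventually (Iio_mem_nhds hc)).exists
  have := hA4 k
  simp only [Function.comp, hDφ] at hk
  exact absurd this (not_le.2 hk)

lemma SStarConvInf.eventually_bounded {x : ℕ → ℝ → ℝ} {x₀ : ℝ → ℝ} (H : SStarConvInf x x₀)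
    (hx : ∀ n, CadlagInf (x n)) (hx₀ : CadlagInf x₀) {T : ℝ} (hT : 0 < T) :
    ∃ C : ℝ, 0 ≤ C ∧ ∀ᶠ n in atTop, ∀ t ∈ Icc 0 T, |x n t| ≤ C := by
  by_contra hcon
  refine H.not_frequently (T := T + 1) (M := 1) hx₀ (by linarith) (one_half_pos (α := ℝ))
    fun k => ?_
  have hk : (0 : ℝ) < k + 1 := by positivity
  have hfr : ∃ᶠ n in atTop, ¬ ∀ t ∈ Icc 0 T, |x n t| ≤ (k : ℝ) + 1 := fun h => hcon
    ⟨k + 1, hk.le, h.mono fun n hn => not_not.1 hn⟩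
  refine hfr.mono fun n hn => ?_
  push Not at hn
  obtain ⟨t, ht, hlt⟩ := hn
  have hxi := (hx n).finIntegrable
  obtain ⟨δ, hδ, hδ0, hδ1⟩ := ((eventually_abs_integral_avgMeas_sub_le ht.1 (hxi _)
    ((hx n).1 t ht.1) (half_pos hk)).and (Ioo_mem_nhdsGT one_pos)).exists
  have hq : ∀ i : Unit, 0 ≤ (fun _ : Unit => t) i ∧ (fun _ : Unit => t) i + δ ≤ T + 1 :=
    fun _ => ⟨ht.1, by simp only; linarith [ht.2]⟩
  have hc1 : |1 / ((k : ℝ) + 1)| = 1 / ((k : ℝ) + 1) := abs_of_pos (by positivity)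
  refine ⟨rampSum (fun _ : Unit => 1 / ((k : ℝ) + 1)) (fun _ => t) δ,
    memA_rampSum (by linarith) hδ0 hq, (eVariationOn_rampSum (by linarith) hδ0 hq).trans ?_,
    fun r _ => ?_, ?_⟩
  · refine ENNReal.ofReal_le_ofReal ?_
    simp only [Finset.univ_unique, Finset.sum_const, Finset.card_singleton, one_smul]
    rw [hc1, div_le_one hk]
    linarith [(Nat.cast_nonneg k : (0 : ℝ) ≤ k)]
  · simp only [rampSum, Finset.univ_unique, Finset.sum_const, Finset.card_singleton, one_smul]
    rw [abs_mul, hc1, abs_of_nonneg (ramp_mem hδ0).1]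
    exact mul_le_of_le_one_right (by positivity) (ramp_mem hδ0).2
  · rw [intD_rampSum hδ0 hq (hxi _)]
    simp only [Finset.univ_unique, Finset.sum_const, Finset.card_singleton, one_smul]
    rw [abs_mul, hc1, div_mul_eq_mul_div, one_mul, le_div_iff₀ hk]
    have := abs_sub_abs_le_abs_sub (x n t) (∫ s, x n s ∂avgMeas t δ)
    rw [abs_sub_comm] at this
    linarith

lemma SStarConvInf.eventually_not_hasChain {x : ℕ → ℝ → ℝ} {x₀ : ℝ → ℝ} (H : SStarConvInf x x₀)
    (hx : ∀ n, CadlagInf (x n)) (hx₀ : CadlagInf x₀) {T ε : ℝ} (hT : 0 < T) (hε : 0 < ε) :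
    ∃ K : ℕ, ∀ᶠ n in atTop, ¬ HasChain 0 T ε (x n) K := by
  by_contra hcon
  refine H.not_frequently (T := T + 1) (M := 2) hx₀ (by linarith) (half_pos hε) fun k => ?_
  have hk : (0 : ℝ) < k + 1 := by positivity
  have hfr : ∃ᶠ n in atTop, HasChain 0 T ε (x n) (k + 1) := fun h => hcon ⟨k + 1, h⟩
  refine hfr.mono fun n hn => ?_
  obtain ⟨p, hp0, hp⟩ := hn
  have hpmem : ∀ i ≤ k + 1, p i ∈ Icc 0 T := by
    intro i hi
    induction i with
    | zero => rw [hp0]; exact ⟨le_rfl, hT.le⟩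
    | succ i ih =>
      exact ⟨(ih (by lia)).1.trans (hp i (by lia)).1.le, (hp i (by lia)).2.1⟩
  have hxi := (hx n).finIntegrable
  have hall : ∀ᶠ δ in 𝓝[>] (0 : ℝ), ∀ i ∈ Finset.range (k + 2),
      |∫ s, x n s ∂avgMeas (p i) δ - x n (p i)| ≤ ε / 4 := by
    rw [Finset.eventually_all]
    intro i hi
    have hm := hpmem i (by rw [Finset.mem_range] at hi; lia)
    exact eventually_abs_integral_avgMeas_sub_le hm.1 (hxi _) ((hx n).1 _ hm.1) (by linarith)
  obtain ⟨δ, hδ, hδ0, hδ1⟩ := (hall.and (Ioo_mem_nhdsGT one_pos)).exists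
  set σ : ℕ → ℝ := fun i => if 0 ≤ x n (p (i + 1)) - x n (p i) then 1 else -1 with hσ
  have hσabs : ∀ i, |σ i| = 1 := fun i => by simp only [hσ]; split_ifs <;> simp
  have hσmul : ∀ i, σ i * (x n (p (i + 1)) - x n (p i)) = |x n (p (i + 1)) - x n (p i)| :=
    fun i => by
    simp only [hσ]
    split_ifs with h
    · rw [one_mul, abs_of_nonneg h]
    · rw [abs_of_neg (not_le.1 h)]; ring
  set c : Fin (k + 1) ⊕ Fin (k + 1) → ℝ :=
    Sum.elim (fun i => σ i / (k + 1)) (fun i => -(σ i / (k + 1))) with hc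
  set q : Fin (k + 1) ⊕ Fin (k + 1) → ℝ :=
    Sum.elim (fun i => p ((i : ℕ) + 1)) (fun i => p i) with hqdef
  have hq : ∀ i, 0 ≤ q i ∧ q i + δ ≤ T + 1 := by
    rintro (i | i)
    · have := hpmem (i + 1) (by lia)
      exact ⟨this.1, by simp only [hqdef, Sum.elim_inl]; linarith [this.2]⟩
    · have := hpmem i (by lia)
      exact ⟨this.1, by simp only [hqdef, Sum.elim_inr]; linarith [this.2]⟩
  have hsum : ∀ g : ℝ → ℝ, ∑ i, c i * g (q i)
      = ∑ i ∈ Finset.range (k + 1), σ i / (k + 1) * (g (p (i + 1)) - g (p i)) := fun g => by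
    rw [Fintype.sum_sum_type, ← Finset.sum_add_distrib, ← Fin.sum_univ_eq_sum_range
      (fun i => σ i / ((k : ℝ) + 1) * (g (p (i + 1)) - g (p i)))]
    refine Finset.sum_congr rfl fun i _ => ?_
    simp only [hc, hqdef, Sum.elim_inl, Sum.elim_inr]
    ring
  have hσk : ∀ i, |σ i / ((k : ℝ) + 1)| = 1 / (k + 1) := fun i => by
    rw [abs_div, hσabs, abs_of_pos hk]
  refine ⟨rampSum c q δ, memA_rampSum (by linarith) hδ0 hq,
    (eVariationOn_rampSum (by linarith) hδ0 hq).trans ?_, fun r _ => ?_, ?_⟩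
  · refine ENNReal.ofReal_le_ofReal (le_of_eq ?_)
    rw [Fintype.sum_sum_type]
    simp only [hc, Sum.elim_inl, Sum.elim_inr, abs_neg, hσk]
    simp only [Finset.sum_const, Finset.card_univ, Fintype.card_fin, nsmul_eq_mul]
    push_cast
    field_simp
    norm_num
  · rw [rampSum, hsum fun s => ramp s δ r]
    calc _ ≤ ∑ i ∈ Finset.range (k + 1), |σ i / (k + 1) * (ramp (p (i + 1)) δ r - ramp (p i) δ r)| :=
          Finset.abs_sum_le_sum_abs _ _
      _ = ∑ i ∈ Finset.range (k + 1), 1 / ((k : ℝ) + 1) * (ramp (p i) δ r - ramp (p (i + 1)) δ r) := by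
          refine Finset.sum_congr rfl fun i hi => ?_
          have := ramp_anti hδ0 (hp i (Finset.mem_range.1 hi)).1.le r
          rw [abs_mul, hσk, abs_of_nonpos (by linarith)]
          ring
      _ = 1 / ((k : ℝ) + 1) * (ramp (p 0) δ r - ramp (p (k + 1)) δ r) := by
          rw [← Finset.mul_sum, Finset.sum_range_sub' (fun i => ramp (p i) δ r)]
      _ ≤ _ := mul_le_of_le_one_right (by positivity) (by
          linarith [(ramp_mem (t := p 0) (r := r) hδ0).2,
            (ramp_mem (t := p (k + 1)) (r := r) hδ0).1])
  · rw [intD_rampSum hδ0 hq (hxi _), hsum fun s => ∫ t, x n t ∂avgMeas s δ]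
    refine le_trans ?_ (le_abs_self _)
    calc ε / 2 = ∑ i ∈ Finset.range (k + 1), 1 / ((k : ℝ) + 1) * (ε / 2) := by
          simp only [Finset.sum_const, Finset.card_range, nsmul_eq_mul]
          push_cast
          field_simp
      _ ≤ _ := Finset.sum_le_sum fun i hi => by
          have hi' := Finset.mem_range.1 hi
          rw [div_mul_eq_mul_div, div_mul_eq_mul_div]
          refine div_le_div_of_nonneg_right ?_ hk.le
          have d1 := hδ (i + 1) (Finset.mem_range.2 (by lia))
          have d0 := hδ i (Finset.mem_range.2 (by lia))
          have d2 := (hp i hi').2.2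
          rw [← hσmul] at d2
          set J1 := ∫ s, x n s ∂avgMeas (p (i + 1)) δ
          set J0 := ∫ s, x n s ∂avgMeas (p i) δ
          have d3 : |σ i * ((J1 - x n (p (i + 1))) - (J0 - x n (p i)))| ≤ ε / 2 := by
            rw [abs_mul, hσabs, one_mul]
            exact (abs_sub _ _).trans (by linarith)
          have d4 := (abs_le.1 d3).1
          have d5 : σ i * (J1 - J0) = σ i * (x n (p (i + 1)) - x n (p i))
            + σ i * ((J1 - x n (p (i + 1))) - (J0 - x n (p i))) := by ring
          linarith

lemma SStarConvInf.exists_stepApprox {x : ℕ → ℝ → ℝ} {x₀ : ℝ → ℝ} (H : SStarConvInf x x₀)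
    (hx : ∀ n, CadlagInf (x n)) (hx₀ : CadlagInf x₀) {T ε : ℝ} (hT : 0 < T) (hε : 0 < ε) :
    ∃ (B : ℕ) (C : ℝ), ∀ n, StepApprox 0 T ε (x n) B C := by
  obtain ⟨C, hC0, hC⟩ := H.eventually_bounded hx hx₀ hT
  obtain ⟨K, hK⟩ := H.eventually_not_hasChain hx hx₀ hT hε
  obtain ⟨N, hN⟩ := eventually_atTop.1 (hC.and hK)
  choose Bs Cs hCs hs using fun n => (hx n).exists_stepApprox hT.le hε
  refine ⟨2 * K + ∑ n ∈ Finset.range N, Bs n, C + ∑ n ∈ Finset.range N, Cs n, fun n => ?_⟩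
  have hsum : 0 ≤ ∑ n ∈ Finset.range N, Cs n := Finset.sum_nonneg fun i _ => hCs i
  rcases lt_or_ge n N with hn | hn
  · have h1 := Finset.single_le_sum (f := Bs) (fun i _ => Nat.zero_le _) (Finset.mem_range.2 hn)
    have h2 := Finset.single_le_sum (f := Cs) (fun i _ => hCs i) (Finset.mem_range.2 hn)
    exact (hs n).mono hT.le (hCs n) (by lia) (by linarith)
  · rcases (hx n).stepApprox_or_hasChain hε hC0 (hN n hn).1 K 0 ⟨le_rfl, hT.le⟩ with h | h
    · exact h.mono hT.le hC0 (by lia) (by linarith)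
    · exact absurd h (hN n hn).2

section stepFun

variable {B : ℕ} {T : ℝ} {a τ : Fin B → ℝ}

lemma cadlagInf_stepFun (a τ : Fin B → ℝ) : CadlagInf (stepFun a τ) := by
  refine ⟨fun t _ => ?_, fun t _ =>
    ⟨∑ k, a k * (if τ k < t then 1 else 0), ?_⟩⟩
  · refine tendsto_finsetSum _ fun k _ => Tendsto.const_mul _ (tendsto_const_nhds.congr' ?_)
    rcases le_or_gt (τ k) t with h | h
    · filter_upwards [self_mem_nhdsWithin] with s hs
      rw [if_pos h, if_pos (h.trans (le_of_lt hs))]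
    · filter_upwards [Ioo_mem_nhdsGT h] with s hs
      rw [if_neg (not_le.2 h), if_neg (not_le.2 hs.2)]
  · refine tendsto_finsetSum _ fun k _ => Tendsto.const_mul _ (tendsto_const_nhds.congr' ?_)
    rcases lt_or_ge (τ k) t with h | h
    · filter_upwards [Ioo_mem_nhdsLT h] with s hs
      rw [if_pos h, if_pos hs.1.le]
    · filter_upwards [self_mem_nhdsWithin] with s hs
      rw [if_neg (not_lt.2 h), if_neg (not_le.2 (lt_of_lt_of_le hs h))]

lemma stepFun_eq_sum_dirac (hτ : ∀ k, 0 ≤ τ k) {t : ℝ} (ht : t ∈ Icc 0 T) :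
    stepFun a τ t = ∑ k, a k * ((Measure.dirac (τ k)).restrict (Icc 0 T)).real (Icc 0 t) := by
  refine Finset.sum_congr rfl fun k _ => ?_
  rw [measureReal_restrict_apply measurableSet_Icc,
    inter_eq_self_of_subset_left (Icc_subset_Icc_right ht.2), measureReal_def,
    Measure.dirac_apply' _ measurableSet_Icc]
  by_cases h : τ k ≤ t
  · rw [if_pos h, indicator_of_mem (show τ k ∈ Icc 0 t from ⟨hτ k, h⟩)]; simp
  · rw [if_neg h, indicator_of_notMem (fun h' : τ k ∈ Icc 0 t => h h'.2)]; simp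

lemma memV_stepFun (hT : 0 ≤ T) (hτ : ∀ k, 0 ≤ τ k) : MemV T (stepFun a τ) := by
  have h := cadlagInf_stepFun a τ
  refine ⟨⟨fun t ht => h.1 t ht.1, fun t ht => h.2 t ht.1⟩, ?_⟩
  exact ((RepPair.eVariationOn_le hT (RepPair.sum a _ (fun k => by
    rw [Measure.restrict_apply measurableSet_Icc.compl, compl_inter_self, measure_empty])
    fun t ht => stepFun_eq_sum_dirac hτ ht)).trans_lt ENNReal.ofReal_lt_top).ne

lemma intD_stepFun (hτ : ∀ k, 0 ≤ τ k) {f : ℝ → ℝ} (hf : Continuous f) :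
    intD T f (stepFun a τ) = ∑ k, a k * (if τ k ≤ T then f (τ k) else 0) := by
  rw [intD_sum a (fun k => (Measure.dirac (τ k)).restrict (Icc 0 T)) (fun k => by
    rw [Measure.restrict_apply measurableSet_Icc.compl, compl_inter_self, measure_empty])
    (fun t ht => stepFun_eq_sum_dirac hτ ht) (hf.finIntegrable T)]
  refine Finset.sum_congr rfl fun k _ => ?_
  classical
  rw [restrict_dirac' measurableSet_Icc]
  by_cases h : τ k ≤ T
  · rw [if_pos h, if_pos (show τ k ∈ Icc 0 T from ⟨hτ k, h⟩), integral_dirac]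
  · rw [if_neg h, if_neg (fun h' : τ k ∈ Icc 0 T => h h'.2), integral_zero_measure]

variable {b σ : ℕ → Fin B → ℝ}

lemma tendsto_ite_le {s : ℕ → ℝ} {s₀ t : ℝ} (hs : Tendsto s atTop (𝓝 s₀)) (h : s₀ ≠ t)
    {g : ℕ → ℝ} {g₀ : ℝ} (hg : Tendsto g atTop (𝓝 g₀)) :
    Tendsto (fun l => if s l ≤ t then g l else 0) atTop (𝓝 (if s₀ ≤ t then g₀ else 0)) := by
  rcases h.lt_or_gt with h | h
  · rw [if_pos h.le]
    refine hg.congr' ?_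
    filter_upwards [hs.eventually (eventually_lt_nhds h)] with l hl
    rw [if_pos hl.le]
  · rw [if_neg (not_le.2 h)]
    refine tendsto_const_nhds.congr' ?_
    filter_upwards [hs.eventually (eventually_gt_nhds h)] with l hl
    rw [if_neg (not_le.2 hl)]

lemma tendsto_stepFun (hb : Tendsto b atTop (𝓝 a)) (hσ : Tendsto σ atTop (𝓝 τ)) {t : ℝ}
    (ht : ∀ k, τ k ≠ t) :
    Tendsto (fun l => stepFun (b l) (σ l) t) atTop (𝓝 (stepFun a τ t)) :=
  tendsto_finsetSum _ fun k _ => (tendsto_pi_nhds.1 hb k).mul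
    (tendsto_ite_le (tendsto_pi_nhds.1 hσ k) (ht k) tendsto_const_nhds)

lemma tendsto_intD_stepFun (hb : Tendsto b atTop (𝓝 a)) (hσ : Tendsto σ atTop (𝓝 τ))
    (hσ0 : ∀ l k, 0 ≤ σ l k) (hT : ∀ k, τ k ≠ T) {f : ℝ → ℝ} (hf : Continuous f) :
    Tendsto (fun l => intD T f (stepFun (b l) (σ l))) atTop (𝓝 (intD T f (stepFun a τ))) := by
  have hτ0 : ∀ k, 0 ≤ τ k := fun k =>
    ge_of_tendsto' (tendsto_pi_nhds.1 hσ k) fun l => hσ0 l k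
  simp only [intD_stepFun (hσ0 _) hf, intD_stepFun hτ0 hf]
  exact tendsto_finsetSum _ fun k _ => (tendsto_pi_nhds.1 hb k).mul
    (tendsto_ite_le (tendsto_pi_nhds.1 hσ k) (hT k)
      ((hf.tendsto _).comp (tendsto_pi_nhds.1 hσ k)))

lemma tendsto_integral_stepFun (hb : Tendsto b atTop (𝓝 a)) (hσ : Tendsto σ atTop (𝓝 τ)) {C : ℝ}
    (hC : ∀ l k, |b l k| ≤ C) {t δ : ℝ} (ht : 0 ≤ t) :
    Tendsto (fun l => ∫ s, stepFun (b l) (σ l) s ∂avgMeas t δ) atTop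
      (𝓝 (∫ s, stepFun a τ s ∂avgMeas t δ)) := by
  refine tendsto_integral_of_dominated_convergence (fun _ => B * C) (fun l => ?_)
    (integrable_const _) (fun l => Eventually.of_forall fun s => ?_) ?_
  · exact ((cadlagInf_stepFun _ _).finIntegrable (t + δ) _ inferInstance
      (avgMeas_null ht le_rfl)).aestronglyMeasurable
  · exact abs_stepFun_le _ _ (hC l) s
  · have h : ∀ᵐ s ∂avgMeas t δ, s ∉ range τ := by
      refine Measure.ae_smul_measure (ae_restrict_of_ae ?_) _
      exact (finite_range τ).countable.ae_notMem volume
    filter_upwards [h] with s hs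
    exact tendsto_stepFun hb hσ fun k hk => hs ⟨k, hk⟩

end stepFun

lemma SStarConvInf.tendsto_integral_avgMeas {x : ℕ → ℝ → ℝ} {x₀ : ℝ → ℝ} (H : SStarConvInf x x₀)
    (hx : ∀ n, CadlagInf (x n)) (hx₀ : CadlagInf x₀) {t δ : ℝ} (ht : 0 ≤ t) (hδ : 0 < δ) :
    Tendsto (fun n => ∫ s, x n s ∂avgMeas t δ) atTop (𝓝 (∫ s, x₀ s ∂avgMeas t δ)) := by
  have hT : 0 < t + δ := by linarith
  have hq : ∀ _ : Unit, 0 ≤ t ∧ t + δ ≤ t + δ := fun _ => ⟨ht, le_rfl⟩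
  have hA : MemA (t + δ) (rampSum (fun _ : Unit => 1) (fun _ => t) δ) := memA_rampSum hT.le hδ hq
  have h := H (t + δ) hT (fun _ => rampSum (fun _ : Unit => 1) (fun _ => t) δ) _ (fun _ => hA) hA
    ⟨fun u hu => Eventually.of_forall fun _ _ _ => refl_mem_uniformity hu,
      ∑ _ : Unit, |(1 : ℝ)|, fun _ => eVariationOn_rampSum hT.le hδ hq⟩
  simpa [intD_rampSum hδ hq, (hx _).finIntegrable, hx₀.finIntegrable] using h

/-- Uniform approximation by convergent step functions passes to the limit. -/
lemma abs_sub_stepFun_le {B : ℕ} {a τ : Fin B → ℝ} {b σ : ℕ → Fin B → ℝ} {y : ℕ → ℝ → ℝ}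
    {x₀ : ℝ → ℝ} {T ε C : ℝ} (hy : ∀ l, CadlagInf (y l)) (hx₀ : CadlagInf x₀)
    (hlim : ∀ t δ, 0 ≤ t → 0 < δ →
      Tendsto (fun l => ∫ s, y l s ∂avgMeas t δ) atTop (𝓝 (∫ s, x₀ s ∂avgMeas t δ)))
    (hb : Tendsto b atTop (𝓝 a)) (hσ : Tendsto σ atTop (𝓝 τ)) (hC : ∀ l k, |b l k| ≤ C)
    (hε : ∀ l, ∀ t ∈ Icc 0 T, |y l t - stepFun (b l) (σ l) t| ≤ ε) {t : ℝ} (ht : t ∈ Ico 0 T) :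
    |x₀ t - stepFun a τ t| ≤ ε := by
  have hv := cadlagInf_stepFun a τ
  refine le_of_forall_pos_le_add fun η hη => ?_
  obtain ⟨δ, ⟨h1, h2⟩, h3⟩ := (((eventually_abs_integral_avgMeas_sub_le ht.1
    (hx₀.finIntegrable _) (hx₀.1 t ht.1) (half_pos hη)).and
    (eventually_abs_integral_avgMeas_sub_le ht.1 (hv.finIntegrable _) (hv.1 t ht.1)
      (half_pos hη))).and (Ioo_mem_nhdsGT (sub_pos.2 ht.2))).exists
  have hδT : t + δ ≤ T := by linarith [h3.2]
  have hnull := avgMeas_null ht.1 hδT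
  have hle : |∫ s, x₀ s ∂avgMeas t δ - ∫ s, stepFun a τ s ∂avgMeas t δ| ≤ ε := by
    refine le_of_tendsto' (((hlim t δ ht.1 h3.1).sub
      (tendsto_integral_stepFun hb hσ hC ht.1)).abs) fun l => ?_
    have hi := (hy l).finIntegrable T _ inferInstance hnull
    have hi' := (cadlagInf_stepFun (b l) (σ l)).finIntegrable T _ inferInstance hnull
    rw [← integral_sub hi hi']
    have := abs_integral_avgMeas_sub_le (c := 0) h3.1 (hi.sub hi') (ε := ε) fun s hs => by
      rw [sub_zero]
      exact hε l s ⟨ht.1.trans hs.1.le, hs.2.trans hδT⟩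
    simpa using this
  rw [abs_le] at *
  constructor <;> linarith [h1.1, h1.2, h2.1, h2.2, hle.1, hle.2]

/-- A countable set can be avoided by times `Tr r` with `r < Tr r < r + 1`. -/
lemma exists_times_notMem {D : Set ℝ} (hD : D.Countable) :
    ∃ Tr : ℕ → ℝ, ∀ r : ℕ, Tr r ∉ D ∧ (r : ℝ) < Tr r ∧ Tr r < r + 1 := by
  refine Classical.skolem (p := fun (r : ℕ) (s : ℝ) => s ∉ D ∧ (r : ℝ) < s ∧ s < r + 1).1 fun r => ?_
  obtain ⟨s, hs, hsD⟩ := hD.dense_compl ℝ |>.exists_between (show (r : ℝ) < r + 1 by linarith)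
  exact ⟨s, hs, hsD.1, hsD.2⟩

lemma SStarConvInf.exists_subseq_sConv {x : ℕ → ℝ → ℝ} {x₀ : ℝ → ℝ} (H : SStarConvInf x x₀)
    (hx : ∀ n, CadlagInf (x n)) (hx₀ : CadlagInf x₀) {φ : ℕ → ℕ} (hφ : StrictMono φ) :
    ∃ ψ : ℕ → ℕ, StrictMono ψ ∧ ∃ Tr : ℕ → ℝ, (∀ r, 0 < Tr r) ∧ StrictMono Tr ∧
      Tendsto Tr atTop atTop ∧ ∀ r : ℕ, SConv (Tr r) (fun l => x (φ (ψ l))) x₀ := by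
  choose B C hBC using fun j : ℕ => H.exists_stepApprox hx hx₀ (T := (j : ℝ) + 1)
    (ε := 1 / ((j : ℝ) + 1)) (by positivity) (by positivity)
  choose a τ ha hτ hε using hBC
  have hK : IsCompact (univ.pi fun j : ℕ =>
      (univ.pi fun _ : Fin (B j) => Icc (-C j) (C j)) ×ˢ
        (univ.pi fun _ : Fin (B j) => Icc (0 : ℝ) (j + 1))) :=
    isCompact_univ_pi fun j => (isCompact_univ_pi fun _ => isCompact_Icc).prod
      (isCompact_univ_pi fun _ => isCompact_Icc)
  obtain ⟨p, -, ψ, hψ, hp⟩ := hK.tendsto_subseq (x := fun n j => (a j (φ n), τ j (φ n)))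
    fun n j _ => ⟨fun k _ => abs_le.1 (ha j _ k), fun k _ => hτ j _ k⟩
  have hpa : ∀ j, Tendsto (fun l => a j (φ (ψ l))) atTop (𝓝 (p j).1) := fun j =>
    (continuous_fst.tendsto _).comp (tendsto_pi_nhds.1 hp j)
  have hpτ : ∀ j, Tendsto (fun l => τ j (φ (ψ l))) atTop (𝓝 (p j).2) := fun j =>
    (continuous_snd.tendsto _).comp (tendsto_pi_nhds.1 hp j)
  obtain ⟨Tr, hTr⟩ := exists_times_notMem (D := ⋃ j, range (p j).2)
    (countable_iUnion fun j => countable_range _)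
  refine ⟨ψ, hψ, Tr, fun r => (Nat.cast_nonneg r).trans_lt (hTr r).2.1,
    strictMono_nat_of_lt_succ fun r => ?_,
    tendsto_atTop_mono (fun r => (hTr r).2.1.le) tendsto_natCast_atTop_atTop, fun r ε hε0 => ?_⟩
  · have := (hTr (r + 1)).2.1
    push_cast at this
    exact (hTr r).2.2.trans this
  have hT0 : 0 < Tr r := (Nat.cast_nonneg r).trans_lt (hTr r).2.1
  obtain ⟨m, hm⟩ := exists_nat_one_div_lt hε0
  set j := max r m
  have hj : 1 / ((j : ℝ) + 1) ≤ ε :=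
    (one_div_le_one_div_of_le (by positivity)
      (by gcongr; exact_mod_cast le_max_right r m)).trans hm.le
  have hTj : Tr r < j + 1 := (hTr r).2.2.trans_le (by gcongr; exact_mod_cast le_max_left r m)
  have hτ0 : ∀ k, 0 ≤ (p j).2 k := fun k =>
    ge_of_tendsto' (tendsto_pi_nhds.1 (hpτ j) k) fun l => (hτ j _ k).1
  refine ⟨fun l => stepFun (a j (φ (ψ l))) (τ j (φ (ψ l))), stepFun (p j).1 (p j).2,
    fun l => memV_stepFun hT0.le fun k => (hτ j _ k).1, memV_stepFun hT0.le hτ0,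
    fun l t ht => (hε j _ t ⟨ht.1, ht.2.trans hTj.le⟩).trans hj, fun t ht => ?_, fun f hf => ?_⟩
  · refine (abs_sub_stepFun_le (fun l => hx _) hx₀ (fun t δ ht hδ => ?_) (hpa j) (hpτ j)
      (fun l => ha j _) (fun l => hε j _) ⟨ht.1, ht.2.trans_lt hTj⟩).trans hj
    exact (H.tendsto_integral_avgMeas hx hx₀ ht hδ).comp (hφ.comp hψ).tendsto_atTop
  · exact tendsto_intD_stepFun (hpa j) (hpτ j) (fun l k => (hτ j _ k).1)
      (fun k hk => (hTr r).1 (mem_iUnion.2 ⟨j, k, hk⟩)) hf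

/-- Integration against the Lebesgue–Stieltjes measure of `v`, as a continuous functional. -/
def RepPair.functional {T : ℝ} {ν₁ ν₂ : Measure ℝ} {v : ℝ → ℝ} (h : RepPair T ν₁ ν₂ v) :
    BoundedContinuousFunction ℝ ℝ →L[ℝ] ℝ :=
  LinearMap.mkContinuous
    { toFun := fun f => intD T f v
      map_add' := fun f g => by
        have e := h.intD_sub ((f + g).continuous.finIntegrable T) (g.continuous.finIntegrable T)
        simp only [BoundedContinuousFunction.coe_add, Pi.add_apply, add_sub_cancel_right] at e
        simp only [BoundedContinuousFunction.coe_add]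
        linarith
      map_smul' := fun c f => by
        rw [h.intD_eq ((c • f).continuous.finIntegrable T), h.intD_eq (f.continuous.finIntegrable T)]
        simp [integral_const_mul, mul_sub] }
    (ν₁.real univ + ν₂.real univ) fun f => by
      rw [mul_comm]
      exact h.abs_intD_le (f.continuous.finIntegrable T) fun t _ => f.norm_coe_le_norm t

/-- Weak convergence of the integrators and uniform convergence of the continuous integrands give
convergence of the integrals. -/
lemma tendsto_intD_of_tendsto {T : ℝ} {α₁ α₂ : ℕ → Measure ℝ} {v : ℕ → ℝ → ℝ} {v₀ : ℝ → ℝ}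
    (h : ∀ l, RepPair T (α₁ l) (α₂ l) (v l))
    (hconv : ∀ f : ℝ → ℝ, Continuous f →
      Tendsto (fun l => intD T f (v l)) atTop (𝓝 (intD T f v₀)))
    {g : ℕ → BoundedContinuousFunction ℝ ℝ} {g₀ : BoundedContinuousFunction ℝ ℝ}
    (hg : Tendsto g atTop (𝓝 g₀)) :
    Tendsto (fun l => intD T (g l) (v l)) atTop (𝓝 (intD T g₀ v₀)) := by
  have hb : ∀ f : BoundedContinuousFunction ℝ ℝ, ∃ C, ∀ l, ‖(h l).functional f‖ ≤ C := fun f => by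
    obtain ⟨C, hC⟩ := (Metric.isBounded_range_of_tendsto _
      (hconv f f.continuous)).exists_norm_le
    exact ⟨C, fun l => hC _ ⟨l, rfl⟩⟩
  obtain ⟨C, hC⟩ := banach_steinhaus hb
  have h0 : Tendsto (fun l => (h l).functional (g l - g₀)) atTop (𝓝 0) := by
    refine squeeze_zero_norm (fun l => ((h l).functional.le_opNorm _).trans
      (mul_le_mul_of_nonneg_right (hC l) (norm_nonneg _))) ?_
    simpa using (tendsto_iff_norm_sub_tendsto_zero.1 hg).const_mul C
  have := h0.add (hconv g₀ g₀.continuous)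
  rw [zero_add] at this
  refine this.congr fun l => ?_
  rw [map_sub]
  exact sub_add_cancel _ _

lemma SConv.tendsto_intD {S M : ℝ} (hS : 0 ≤ S) {y : ℕ → ℝ → ℝ} {x₀ : ℝ → ℝ} (H : SConv S y x₀)
    (hy : ∀ l, FinIntegrable S (y l)) (hx₀ : FinIntegrable S x₀)
    {ν₁ ν₂ : ℕ → Measure ℝ} {μ₁ μ₂ : Measure ℝ} {A : ℕ → ℝ → ℝ} {A₀ : ℝ → ℝ}
    (hA : ∀ l, RepPair S (ν₁ l) (ν₂ l) (A l)) (hA₀ : RepPair S μ₁ μ₂ A₀)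
    (hM : ∀ l, (ν₁ l).real univ + (ν₂ l).real univ ≤ M) (hM₀ : μ₁.real univ + μ₂.real univ ≤ M)
    {g : ℕ → BoundedContinuousFunction ℝ ℝ} {g₀ : BoundedContinuousFunction ℝ ℝ}
    (hgA : ∀ l, g l = A l) (hgA₀ : g₀ = A₀) (h0 : ∀ l, A l 0 = 0) (h0₀ : A₀ 0 = 0)
    (hg : Tendsto g atTop (𝓝 g₀)) :
    Tendsto (fun l => intD S (y l) (A l)) atTop (𝓝 (intD S x₀ A₀)) := by
  have hM0 : 0 ≤ M := le_trans (by positivity) hM₀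
  rw [Metric.tendsto_atTop']
  intro η hη
  set ε := η / (2 * M + 2) with hεdef
  have hε : 0 < ε := by positivity
  have hεη : ε * (2 * M + 2) = η := div_mul_cancel₀ _ (by positivity)
  obtain ⟨v, v₀, hv, hv₀, hyv, hxv, hconv⟩ := H ε hε
  choose α₁ α₂ hα _ using fun l => exists_repPair hS (hv l).1.1 (hv l).2
  obtain ⟨β₁, β₂, hβ, -⟩ := exists_repPair hS hv₀.1.1 hv₀.2
  have hclose : ∀ {w z B : ℝ → ℝ} {ρ₁ ρ₂ : Measure ℝ}, RepPair S ρ₁ ρ₂ B → FinIntegrable S w →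
      FinIntegrable S z → (∀ t ∈ Icc 0 S, |w t - z t| ≤ ε) → ρ₁.real univ + ρ₂.real univ ≤ M →
      |intD S w B - intD S z B| ≤ ε * M := fun hB hw hz hwz hρ => by
    rw [← hB.intD_sub hw hz]
    exact (hB.abs_intD_le (fun ν a b => (hw ν a b).sub (hz ν a b)) hwz).trans
      (mul_le_mul_of_nonneg_left hρ hε.le)
  have hparts : Tendsto (fun l => intD S (v l) (A l)) atTop (𝓝 (intD S v₀ A₀)) := by
    have hc : Tendsto (fun l => BoundedContinuousFunction.const ℝ (g l S) - g l) atTop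
        (𝓝 (BoundedContinuousFunction.const ℝ (g₀ S) - g₀)) := by
      refine Tendsto.sub ?_ hg
      rw [tendsto_iff_dist_tendsto_zero]
      refine squeeze_zero (fun _ => dist_nonneg) (fun l => ?_)
        (tendsto_iff_dist_tendsto_zero.1 hg)
      exact (BoundedContinuousFunction.dist_le dist_nonneg).2 fun _ =>
        BoundedContinuousFunction.dist_coe_le_dist S
    have h := tendsto_intD_of_tendsto hα hconv hc
    rw [intD_by_parts hβ hA₀ (hgA₀ ▸ g₀.continuous) h0₀, ← hgA₀]
    refine h.congr fun l => ?_
    rw [intD_by_parts (hα l) (hA l) (hgA l ▸ (g l).continuous) (h0 l), ← hgA l]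
    rfl
  obtain ⟨N, hN⟩ := Metric.tendsto_atTop'.1 hparts ε hε
  refine ⟨N, fun l hl => ?_⟩
  have e1 := hclose (hA l) (hy l) (hα l).finIntegrable (hyv l) (hM l)
  have e2 := hclose hA₀ hx₀ hβ.finIntegrable hxv hM₀
  have e3 := hN l hl
  rw [Real.dist_eq] at e3 ⊢
  rw [abs_le] at e1 e2
  rw [abs_lt] at e3 ⊢
  constructor <;> nlinarith [e1.1, e1.2, e2.1, e2.2, e3.1, e3.2]

/-- Freezing an integrator after time `T` keeps its measure. -/
lemma RepPair.extend {S T : ℝ} (hT : 0 ≤ T) (hTS : T ≤ S) {ν₁ ν₂ : Measure ℝ} {A : ℝ → ℝ}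
    (h : RepPair T ν₁ ν₂ A) : RepPair S ν₁ ν₂ (fun t => A (projIcc 0 T hT t)) := by
  have := h.fin₁
  have := h.fin₂
  have hsub : (Icc 0 S)ᶜ ⊆ (Icc 0 T)ᶜ := compl_subset_compl.2 (Icc_subset_Icc_right hTS)
  refine ⟨h.fin₁, h.fin₂, measure_mono_null hsub h.null₁, measure_mono_null hsub h.null₂,
    fun t ht => ?_⟩
  rcases le_total t T with htT | htT
  · simp only [projIcc_of_mem hT ⟨ht.1, htT⟩]
    exact h.eq t ⟨ht.1, htT⟩
  · have key : ∀ ν : Measure ℝ, ν (Icc 0 T)ᶜ = 0 → ν.real (Icc 0 t) = ν.real (Icc 0 T) :=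
      fun ν hν => by
      have hae : ∀ᵐ s ∂ν, s ∈ Icc 0 T := by rw [ae_iff]; exact hν
      refine measureReal_congr (hae.mono fun s hs => propext ⟨fun _ => hs, fun _ => ?_⟩)
      exact ⟨hs.1, hs.2.trans htT⟩
    simp only [projIcc_of_right_le hT htT]
    rw [key _ h.null₁, key _ h.null₂]
    exact h.eq T ⟨hT, le_rfl⟩

lemma MemA.exists_repPair {T M : ℝ} {A : ℝ → ℝ} (hT : 0 ≤ T) (hA : MemA T A)
    (hM : eVariationOn A (Icc 0 T) ≤ ENNReal.ofReal M) :
    ∃ ν₁ ν₂, RepPair T ν₁ ν₂ A ∧ ν₁.real univ + ν₂.real univ ≤ 3 * max M 0 := by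
  obtain ⟨ν₁, ν₂, h, hle⟩ := _root_.exists_repPair hT (v := A) (fun t ht => by
    refine (hA.1 t ⟨ht.1, ht.2.le⟩).mono_left ?_
    rw [← nhdsWithin_Ioo_eq_nhdsGT ht.2]
    exact nhdsWithin_mono _ fun s hs => ⟨ht.1.trans hs.1.le, hs.2.le⟩) hA.2.1
  refine ⟨ν₁, ν₂, h, hle.trans ?_⟩
  rw [hA.2.2, abs_zero, add_zero, ← ENNReal.toReal_ofReal']
  gcongr
  exact ENNReal.ofReal_ne_top

/-- The integrator `A` frozen outside `[0,T]`, as a bounded continuous function. -/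
def MemA.extend {T : ℝ} {A : ℝ → ℝ} (hT : 0 ≤ T) (hA : MemA T A) :
    BoundedContinuousFunction ℝ ℝ :=
  (BoundedContinuousFunction.mkOfCompact ⟨fun t : Icc 0 T => A t, hA.1.domRestrict⟩).compContinuous
    ⟨projIcc 0 T hT, continuous_projIcc⟩

lemma sStarConvInf_of_subseq_sConv {x : ℕ → ℝ → ℝ} {x₀ : ℝ → ℝ}
    (hx : ∀ n, CadlagInf (x n)) (hx₀ : CadlagInf x₀)
    (H : ∀ φ : ℕ → ℕ, StrictMono φ → ∃ ψ : ℕ → ℕ, StrictMono ψ ∧ ∃ Tr : ℕ → ℝ,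
      Tendsto Tr atTop atTop ∧ ∀ r : ℕ, SConv (Tr r) (fun l => x (φ (ψ l))) x₀) :
    SStarConvInf x x₀ := by
  intro T hT A A₀ hA hA₀ hτ
  refine tendsto_of_subseq_tendsto fun ns hns => ?_
  obtain ⟨φ, hφ, hnsφ⟩ := strictMono_subseq_of_tendsto_atTop hns
  obtain ⟨ψ, hψ, Tr, hTr, hS⟩ := H _ hnsφ
  refine ⟨fun l => φ (ψ l), ?_⟩
  obtain ⟨r, hr⟩ := (hTr.eventually_ge_atTop T).exists
  obtain ⟨hunif, M, hM⟩ := hτ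
  choose ν₁ ν₂ hν hνM using fun n => (hA n).exists_repPair hT.le (hM n)
  obtain ⟨μ₁, μ₂, hμ, hμM⟩ := hA₀.exists_repPair hT.le (ENNReal.ofReal_toReal hA₀.2.1).ge
  have hE := fun n => (hν n).extend hT.le hr
  have hE₀ := hμ.extend hT.le hr
  have e : ∀ n m, intD T (x m) (A n) = intD (Tr r) (x m) fun t => A n (projIcc 0 T hT.le t) :=
    fun n m => by
    rw [(hν n).intD_eq ((hx m).finIntegrable _), (hE n).intD_eq ((hx m).finIntegrable _)]
  have e₀ : intD T x₀ A₀ = intD (Tr r) x₀ fun t => A₀ (projIcc 0 T hT.le t) := by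
    rw [hμ.intD_eq (hx₀.finIntegrable _), hE₀.intD_eq (hx₀.finIntegrable _)]
  simp only [e, e₀]
  have hproj0 : (projIcc 0 T hT.le 0 : ℝ) = 0 := by simp
  have hg : Tendsto (fun n => (hA n).extend hT.le) atTop (𝓝 (hA₀.extend hT.le)) := by
    rw [BoundedContinuousFunction.tendsto_iff_tendstoUniformly, Metric.tendstoUniformly_iff]
    intro ε hε
    filter_upwards [Metric.tendstoUniformlyOn_iff.1 hunif ε hε] with n hn t
    exact hn _ (projIcc 0 T hT.le t).2
  exact (hS r).tendsto_intD (hT.le.trans hr) (fun l => (hx _).finIntegrable _)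
    (hx₀.finIntegrable _) (fun l => hE (ns (φ (ψ l)))) hE₀
    (fun l => (hνM _).trans (le_max_left _ _)) (hμM.trans (le_max_right _ _))
    (g := fun l => (hA (ns (φ (ψ l)))).extend hT.le) (g₀ := hA₀.extend hT.le)
    (fun l => rfl) rfl (fun l => by simpa only [hproj0] using (hA _).2.2)
    (by simpa only [hproj0] using hA₀.2.2)
    (hg.comp (hnsφ.comp hψ).tendsto_atTop)

/-- Theorem 5.4: characterization of `⇒*_S` in `D([0,∞))` via `→_S` of restrictions. -/
theorem stmt13 (x : ℕ → ℝ → ℝ) (x₀ : ℝ → ℝ)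
    (hx : ∀ n, CadlagInf (x n)) (hx₀ : CadlagInf x₀) :
    SStarConvInf x x₀ ↔
      ∀ φ : ℕ → ℕ, StrictMono φ → ∃ ψ : ℕ → ℕ, StrictMono ψ ∧ ∃ Tr : ℕ → ℝ,
        (∀ r, 0 < Tr r) ∧ StrictMono Tr ∧
        Filter.Tendsto Tr Filter.atTop Filter.atTop ∧
        ∀ r : ℕ, SConv (Tr r) (fun l => x (φ (ψ l))) x₀ := by
  refine ⟨fun H φ hφ => H.exists_subseq_sConv hx hx₀ hφ, fun H =>
    sStarConvInf_of_subseq_sConv hx hx₀ fun φ hφ => ?_⟩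
  obtain ⟨ψ, hψ, Tr, -, -, hTr, hS⟩ := H φ hφ
  exact ⟨ψ, hψ, Tr, hTr, hS⟩

end
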